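/- Let K be a field with 6 invertible in K, let B ∈ Mat₆(K[y₁,y₂,y₃]₁) be a skew-symmetric matrix of linear forms such that det(B) = f² for a smooth homogeneous cubic f ∈ K[y₁,y₂,y₃] whose zero locus E has a K-rational flex point, and let G = G_B(K) be the Baer group of the tensor t represented by B. Then: (1) the adjoint *-algebra Adj(t) is *-isomorphic to X₁(K) if and only if there exist a,b ∈ K with 4a³ + 27b² ≠ 0, an affine point P = (λ,μ) on E_W : y² = x³ + ax + b with μ ≠ 0 (i.e. P ∉ E_W[2](K)), a matrix Z ∈ GL₃(K) and c ∈ K^× with c·f(Z·(x,y,z)) = y²z − x³ − axz² − bz³, such that G ≅ G_{E_W,P}(K); (2) Adj(t) is *-isomorphic to S₂(K) if and only if such data exist with μ = 0 (i.e. P ∈ E_W[2](K)∖{O}). -/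

import Mathlib

open Matrix

/-- The Baer multiplication on `V × T` associated with a bilinear map `t`. -/
def baerMul {K V T : Type*} [Field K] [AddCommGroup V] [Module K V]
    [AddCommGroup T] [Module K T] (t : V → V → T) (x y : V × T) : V × T :=
  (x.1 + y.1, x.2 + y.2 + (2 : K)⁻¹ • t x.1 y.1)

/-- The tensor `(u, v) ↦ (uᵀ B₁ v, …, uᵀ B_d v)` given coefficient matrices. -/
def matTensor {K : Type*} [CommRing K] {ι : Type*} [Fintype ι] {d : ℕ}
    (B : Fin d → Matrix ι ι K) (u v : ι → K) : Fin d → K :=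
  fun k => u ⬝ᵥ (B k).mulVec v

/-- The matrix of linear forms `B = B₁y₁ + ⋯ + B_d y_d` over `K[y₁,…,y_d]`. -/
noncomputable def polyMat {K : Type*} [CommRing K] {ι : Type*} {d : ℕ}
    (B : Fin d → Matrix ι ι K) : Matrix ι ι (MvPolynomial (Fin d) K) :=
  Matrix.of fun i j => ∑ k, MvPolynomial.C (B k i j) * MvPolynomial.X k

/-- Coefficient matrices of `J_{E,P}` (variables `x, y, z`). -/
def Jmat {K : Type*} [CommRing K] (a lam mu : K) : Fin 3 → Matrix (Fin 3) (Fin 3) K :=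
  ![!![1, 0, 0; 0, lam, 1; 0, 1, 0],
    !![0, 1, 0; 1, 0, 0; 0, 0, 0],
    !![-lam, -mu, 0; mu, a + lam ^ 2, 0; 0, 0, -1]]

/-- Coefficient matrices of `B_{E,P} = [[0, J_{E,P}], [−J_{E,P}ᵀ, 0]]`. -/
def BmatEP {K : Type*} [CommRing K] (a lam mu : K) :
    Fin 3 → Matrix (Fin 3 ⊕ Fin 3) (Fin 3 ⊕ Fin 3) K :=
  fun k => Matrix.fromBlocks 0 (Jmat a lam mu k) (-(Jmat a lam mu k)ᵀ) 0

/-- The alternating tensor `K⁶ × K⁶ → K³` represented by `B_{E,P}`. -/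
def epTensor {K : Type*} [CommRing K] (a lam mu : K) :
    ((Fin 3 ⊕ Fin 3) → K) → ((Fin 3 ⊕ Fin 3) → K) → (Fin 3 → K) :=
  matTensor (BmatEP a lam mu)

/-- A homogeneous cubic `f ∈ K[y₁,y₂,y₃]` is smooth if `f` and its three partial derivatives
have no common nontrivial zero over an algebraic closure of `K`. -/
def SmoothCubic {K : Type*} [Field K] (f : MvPolynomial (Fin 3) K) : Prop :=
  f.IsHomogeneous 3 ∧
    ∀ v : Fin 3 → AlgebraicClosure K, v ≠ 0 →
      ¬ ((MvPolynomial.aeval v) f = 0 ∧ ∀ k, (MvPolynomial.aeval v) (MvPolynomial.pderiv k f) = 0)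

/-- The zero locus of `f` has a `K`-rational flex point. -/
noncomputable def HasRationalFlex {K : Type*} [Field K] (f : MvPolynomial (Fin 3) K) : Prop :=
  ∃ v : Fin 3 → K, v ≠ 0 ∧ MvPolynomial.eval v f = 0 ∧
    MvPolynomial.eval v
      (Matrix.det (Matrix.of fun i j => MvPolynomial.pderiv i (MvPolynomial.pderiv j f))) = 0

/-- The adjoint algebra in matrix form: pairs `(A, C)` with `Aᵀ·B_k = B_k·C`. -/
def adjPair {K : Type*} [CommRing K] {ι : Type*} [Fintype ι] [DecidableEq ι] {d : ℕ}
    (M : Fin d → Matrix ι ι K) : Set (Matrix ι ι K × Matrix ι ι K) :=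
  {p | ∀ k, (p.1)ᵀ * M k = M k * p.2}

/-- `A` is *-isomorphic to the *-algebra `X₁(K) = K ⊕ K` with the swap involution. -/
def StarIsoX1 {K : Type*} [Field K] {ι : Type*} [Fintype ι] [DecidableEq ι]
    (A : Set (Matrix ι ι K × Matrix ι ι K)) : Prop :=
  ∃ e : A ≃ (K × K),
    (∀ x y z : A, z.val = x.val + y.val → e z = e x + e y) ∧
    (∀ (c : K) (x z : A), z.val = c • x.val → e z = c • e x) ∧
    (∀ x y z : A, z.val.1 = x.val.1 * y.val.1 ∧ z.val.2 = y.val.2 * x.val.2 →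
      e z = e x * e y) ∧
    (∀ z : A, z.val = 1 → e z = 1) ∧
    (∀ x z : A, z.val.1 = x.val.2 ∧ z.val.2 = x.val.1 → e z = Prod.swap (e x))

/-- `A` is *-isomorphic to the *-algebra `S₂(K) = Mat₂(K)` with involution `X ↦ J·Xᵀ·J⁻¹`,
`J = [[0,1],[−1,0]]`. -/
def StarIsoS2 {K : Type*} [Field K] {ι : Type*} [Fintype ι] [DecidableEq ι]
    (A : Set (Matrix ι ι K × Matrix ι ι K)) : Prop :=
  ∃ e : A ≃ Matrix (Fin 2) (Fin 2) K,
    (∀ x y z : A, z.val = x.val + y.val → e z = e x + e y) ∧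
    (∀ (c : K) (x z : A), z.val = c • x.val → e z = c • e x) ∧
    (∀ x y z : A, z.val.1 = x.val.1 * y.val.1 ∧ z.val.2 = y.val.2 * x.val.2 →
      e z = e x * e y) ∧
    (∀ z : A, z.val = 1 → e z = 1) ∧
    (∀ x z : A, z.val.1 = x.val.2 ∧ z.val.2 = x.val.1 →
      e z = !![0, 1; -1, 0] * (e x)ᵀ * !![0, -1; 1, 0])

/-- `G_B(K)` is isomorphic to `G_{E_W,P}(K)` for the short Weierstrass curve
`E_W : y² = x³ + ax + b` and the affine point `P = (λ, μ)`, where the zero locus of `f`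
maps to `E_W` by a linear change of coordinates `Z` (up to the scalar `c`):
`c·f(Z·(x,y,z)) = y²z − x³ − axz² − bz³`. -/
def IsEPForm {K : Type*} [Field K] (B : Fin 3 → Matrix (Fin 6) (Fin 6) K)
    (f : MvPolynomial (Fin 3) K) (a b lam mu : K) : Prop :=
  4 * a ^ 3 + 27 * b ^ 2 ≠ 0 ∧ mu ^ 2 = lam ^ 3 + a * lam + b ∧
    (∃ Z : Matrix (Fin 3) (Fin 3) K, IsUnit Z ∧ ∃ c : K, c ≠ 0 ∧
      MvPolynomial.C c *
          (MvPolynomial.bind₁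
            (fun i : Fin 3 => ∑ j : Fin 3, MvPolynomial.C (Z i j) * MvPolynomial.X j)) f =
        MvPolynomial.X 1 ^ 2 * MvPolynomial.X 2 - MvPolynomial.X 0 ^ 3 -
          MvPolynomial.C a * MvPolynomial.X 0 * MvPolynomial.X 2 ^ 2 -
          MvPolynomial.C b * MvPolynomial.X 2 ^ 3) ∧
    (∃ e : (Fin 6 → K) × (Fin 3 → K) ≃ ((Fin 3 ⊕ Fin 3) → K) × (Fin 3 → K),
      ∀ x y, e (baerMul (K := K) (matTensor B) x y) =
        baerMul (K := K) (epTensor a lam mu) (e x) (e y))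

/-! ### The adjoint algebra of `t_{E,P}` -/

theorem Jmat_transpose {K : Type*} [CommRing K] (a lam mu : K) (k : Fin 3) :
    (Jmat a lam mu k)ᵀ = Jmat a lam (-mu) k := by
  fin_cases k <;> ext i j <;> fin_cases i <;> fin_cases j <;> simp [Jmat]

/-- Two matrices intertwining `J_{E,P}` and `J_{E,Q}`, where `P = (λ, μ)` and `Q = (λ, ν)`, are
equal scalar matrices, and vanish unless `μ = ν`. -/
theorem Jmat_intertwiner {K : Type*} [CommRing K] {a lam mu nu : K}
    {X Y : Matrix (Fin 3) (Fin 3) K} (h : ∀ k, X * Jmat a lam mu k = Jmat a lam nu k * Y) :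
    X = X 0 0 • 1 ∧ Y = X 0 0 • 1 ∧ X 0 0 * mu = X 0 0 * nu := by
  have H : ∀ k i j, (X * Jmat a lam mu k) i j = (Jmat a lam nu k * Y) i j := fun k i j => by
    rw [h k]
  simp only [Fin.forall_fin_succ, Jmat, Matrix.mul_apply, Fin.sum_univ_succ] at H
  simp at H
  obtain ⟨⟨⟨h1, h2, h3⟩, ⟨h4, h5, h6⟩, h7, h8, h9⟩, ⟨⟨k1, k2, k3⟩, ⟨k4, k5, k6⟩, k7, k8⟩,
    ⟨l1, l2, l3⟩, ⟨l4, l5, l6⟩, l7, l8, l9⟩ := H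
  have X01 : X 0 1 = 0 := by grind
  have X02 : X 0 2 = 0 := by grind
  have X10 : X 1 0 = 0 := by grind
  have X12 : X 1 2 = 0 := by grind
  have X20 : X 2 0 = 0 := by grind
  have X21 : X 2 1 = 0 := by grind
  have X11 : X 1 1 = X 0 0 := by grind
  have X22 : X 2 2 = X 0 0 := by grind
  refine ⟨?_, ?_, by grind⟩
  · ext i j
    fin_cases i <;> fin_cases j <;> simp <;> grind
  · ext i j
    fin_cases i <;> fin_cases j <;> simp <;> grind

/-- The adjointness condition for `t_{E,P}` in terms of blocks. -/
theorem mem_adjPair_BmatEP_iff {K : Type*} [CommRing K] {a lam mu : K}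
    {p : Matrix (Fin 3 ⊕ Fin 3) (Fin 3 ⊕ Fin 3) K × Matrix (Fin 3 ⊕ Fin 3) (Fin 3 ⊕ Fin 3) K} :
    p ∈ adjPair (BmatEP a lam mu) ↔ ∃ q r s t : K,
      q * mu = -(q * mu) ∧ r * mu = -(r * mu) ∧
      p.1 = Matrix.fromBlocks (s • 1) (q • 1) (r • 1) (t • 1) ∧
      p.2 = Matrix.fromBlocks (t • 1) (-q • 1) (-r • 1) (s • 1) := by
  obtain ⟨A, C⟩ := p
  constructor
  · intro h
    have h' : ∀ k, Aᵀ * BmatEP a lam mu k = BmatEP a lam mu k * C := h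
    rw [← Matrix.fromBlocks_toBlocks A, ← Matrix.fromBlocks_toBlocks C] at h' ⊢
    generalize A.toBlocks₁₁ = A11, A.toBlocks₁₂ = A12, A.toBlocks₂₁ = A21, A.toBlocks₂₂ = A22,
      C.toBlocks₁₁ = C11, C.toBlocks₁₂ = C12, C.toBlocks₂₁ = C21, C.toBlocks₂₂ = C22 at h' ⊢
    simp only [BmatEP, Matrix.fromBlocks_transpose, Matrix.fromBlocks_multiply, mul_zero, zero_mul,
      zero_add, add_zero, Matrix.fromBlocks_inj, mul_neg, neg_mul, neg_inj, Jmat_transpose] at h'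
    obtain ⟨e1, e2, e3⟩ := Jmat_intertwiner (X := A11ᵀ) (Y := C22) fun k => (h' k).2.1
    obtain ⟨f1, f2, f3⟩ := Jmat_intertwiner (X := A22ᵀ) (Y := C11) fun k => (h' k).2.2.1
    obtain ⟨g1, g2, g3⟩ := Jmat_intertwiner (X := A12ᵀ) (Y := -C12) (a := a) (lam := lam)
      (mu := mu) (nu := -mu) fun k => by rw [(h' k).2.2.2, mul_neg]
    obtain ⟨i1, i2, i3⟩ := Jmat_intertwiner (X := A21ᵀ) (Y := -C21) (a := a) (lam := lam)
      (mu := -mu) (nu := mu) fun k => by rw [mul_neg, ← (h' k).1, neg_neg]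
    refine ⟨A12 0 0, A21 0 0, A11 0 0, A22 0 0, by simpa using g3, ?_, ?_, ?_⟩
    · simpa using i3.symm
    · have e1' := congrArg Matrix.transpose e1
      have f1' := congrArg Matrix.transpose f1
      have g1' := congrArg Matrix.transpose g1
      have i1' := congrArg Matrix.transpose i1
      simp only [Matrix.transpose_transpose, Matrix.transpose_smul, Matrix.transpose_one,
        Matrix.transpose_apply] at e1' f1' g1' i1'
      simp only [Matrix.fromBlocks_inj]
      exact ⟨e1', g1', i1', f1'⟩
    · rw [neg_eq_iff_eq_neg] at g2 i2
      simp only [Matrix.fromBlocks_inj, neg_smul]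
      exact ⟨f2, g2, i2, e2⟩
  · rintro ⟨q, r, s, t, hq, hr, h1, h2⟩ k
    simp only at h1 h2
    simp only [h1, h2, BmatEP, Matrix.fromBlocks_transpose, Matrix.fromBlocks_multiply, mul_zero,
      zero_mul, zero_add, add_zero, Matrix.fromBlocks_inj, mul_neg, neg_mul, neg_inj,
      Jmat_transpose, Matrix.transpose_smul, Matrix.transpose_one, Matrix.smul_mul,
      Matrix.mul_smul, one_mul, mul_one, neg_smul, neg_neg]
    refine ⟨?_, by simp, by simp, ?_⟩
    · fin_cases k <;> ext i j <;> fin_cases i <;> fin_cases j <;> simp [Jmat] <;> grind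
    · fin_cases k <;> ext i j <;> fin_cases i <;> fin_cases j <;> simp [Jmat] <;> grind

/-! ### Transport of adjoint algebras -/

/-- The adjoint algebra `A` is *-isomorphic to `D` with involution `st`. -/
def StarIsoTo {K : Type*} [Field K] {ι : Type*} [Fintype ι] [DecidableEq ι]
    (A : Set (Matrix ι ι K × Matrix ι ι K)) (D : Type*) [Ring D] [SMul K D] (st : D → D) : Prop :=
  ∃ e : A ≃ D,
    (∀ x y z : A, z.val = x.val + y.val → e z = e x + e y) ∧
    (∀ (c : K) (x z : A), z.val = c • x.val → e z = c • e x) ∧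
    (∀ x y z : A, z.val.1 = x.val.1 * y.val.1 ∧ z.val.2 = y.val.2 * x.val.2 →
      e z = e x * e y) ∧
    (∀ z : A, z.val = 1 → e z = 1) ∧
    (∀ x z : A, z.val.1 = x.val.2 ∧ z.val.2 = x.val.1 → e z = st (e x))

section Adjoint

variable {K : Type*} [Field K] {ι : Type*} [Fintype ι] [DecidableEq ι] {d : ℕ}

theorem starIsoX1_iff {A : Set (Matrix ι ι K × Matrix ι ι K)} :
    StarIsoX1 A ↔ StarIsoTo A (K × K) Prod.swap := Iff.rfl

theorem starIsoS2_iff {A : Set (Matrix ι ι K × Matrix ι ι K)} :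
    StarIsoS2 A ↔ StarIsoTo A (Matrix (Fin 2) (Fin 2) K)
      fun X => !![0, 1; -1, 0] * Xᵀ * !![0, -1; 1, 0] := Iff.rfl

theorem one_mem_adjPair (M : Fin d → Matrix ι ι K) : 1 ∈ adjPair M := fun k => by simp

theorem mul_mem_adjPair {M : Fin d → Matrix ι ι K} {p q : Matrix ι ι K × Matrix ι ι K}
    (hp : p ∈ adjPair M) (hq : q ∈ adjPair M) : (p.1 * q.1, q.2 * p.2) ∈ adjPair M := fun k => by
  have hp' : p.1ᵀ * M k = M k * p.2 := hp k
  have hq' : q.1ᵀ * M k = M k * q.2 := hq k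
  change (p.1 * q.1)ᵀ * M k = M k * (q.2 * p.2)
  rw [Matrix.transpose_mul, mul_assoc, hp', ← mul_assoc, hq', mul_assoc]

theorem add_mem_adjPair {M : Fin d → Matrix ι ι K} {p q : Matrix ι ι K × Matrix ι ι K}
    (hp : p ∈ adjPair M) (hq : q ∈ adjPair M) : p + q ∈ adjPair M := fun k => by
  have hp' : p.1ᵀ * M k = M k * p.2 := hp k
  have hq' : q.1ᵀ * M k = M k * q.2 := hq k
  change (p.1 + q.1)ᵀ * M k = M k * (p.2 + q.2)
  rw [Matrix.transpose_add, add_mul, hp', hq', mul_add]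

theorem swap_mem_adjPair {M : Fin d → Matrix ι ι K} (hM : ∀ k, (M k)ᵀ = -M k)
    {p : Matrix ι ι K × Matrix ι ι K} (hp : p ∈ adjPair M) : p.swap ∈ adjPair M := fun k => by
  have hp' : p.1ᵀ * M k = M k * p.2 := hp k
  have := congrArg Matrix.transpose hp'
  simpa [Matrix.transpose_mul, hM] using this.symm

/-- An element `x` with `x² = x` and `x + x* = 1` yields an idempotent adjoint to its complement. -/
theorem StarIsoTo.exists_idempotent {M : Fin d → Matrix ι ι K} (hM : ∀ k, (M k)ᵀ = -M k)
    {D : Type*} [Ring D] [SMul K D] {st : D → D} (h : StarIsoTo (adjPair M) D st)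
    {x : D} (hx : x * x = x) (hst : x + st x = 1) :
    ∃ P : Matrix ι ι K, P * P = P ∧ ∀ k, Pᵀ * M k = M k * (1 - P) := by
  obtain ⟨e, hadd, -, hmul, hone, hstar⟩ := h
  obtain ⟨p, hp⟩ : ∃ p, p = e.symm x := ⟨_, rfl⟩
  have hep : e p = x := by simp [hp]
  have h1 : (⟨_, mul_mem_adjPair p.2 p.2⟩ : adjPair M) = p := e.injective <| by
    rw [hmul p p _ ⟨rfl, rfl⟩, hep, hx]
  have h2 : (⟨_, add_mem_adjPair p.2 (swap_mem_adjPair hM p.2)⟩ : adjPair M) =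
      ⟨1, one_mem_adjPair M⟩ := e.injective <| by
    rw [hadd p ⟨_, swap_mem_adjPair hM p.2⟩ _ rfl, hstar p ⟨_, swap_mem_adjPair hM p.2⟩ ⟨rfl, rfl⟩,
      hep, hst, hone _ rfl]
  have h3 : p.val.1 * p.val.1 = p.val.1 := congrArg (fun q : adjPair M => q.val.1) h1
  have h4 : p.val.1 + p.val.2 = 1 := congrArg (fun q : adjPair M => q.val.1) h2
  refine ⟨p.val.1, h3, fun k => ?_⟩
  rw [← h4, add_sub_cancel_left]
  exact p.2 k

theorem StarIsoTo.mul_comm {M : Fin d → Matrix ι ι K} {D D' : Type*} [Ring D] [SMul K D]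
    {st : D → D} [Ring D'] [SMul K D'] {st' : D' → D'} (h : StarIsoTo (adjPair M) D st)
    (h' : StarIsoTo (adjPair M) D' st') (hD : ∀ x y : D, x * y = y * x) (x y : D') :
    x * y = y * x := by
  obtain ⟨e, -, -, hmul, -, -⟩ := h
  obtain ⟨e', -, -, hmul', -, -⟩ := h'
  have hc (p q : adjPair M) :
      (⟨(p.val.1 * q.val.1, q.val.2 * p.val.2), mul_mem_adjPair p.2 q.2⟩ : adjPair M) =
        ⟨(q.val.1 * p.val.1, p.val.2 * q.val.2), mul_mem_adjPair q.2 p.2⟩ :=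
    e.injective <| by
      rw [hmul p q ⟨_, mul_mem_adjPair p.2 q.2⟩ ⟨rfl, rfl⟩,
        hmul q p ⟨_, mul_mem_adjPair q.2 p.2⟩ ⟨rfl, rfl⟩, hD]
  have := congrArg e' (hc (e'.symm x) (e'.symm y))
  rw [hmul' (e'.symm x) (e'.symm y) ⟨_, mul_mem_adjPair (e'.symm x).2 (e'.symm y).2⟩ ⟨rfl, rfl⟩,
    hmul' (e'.symm y) (e'.symm x) ⟨_, mul_mem_adjPair (e'.symm y).2 (e'.symm x).2⟩ ⟨rfl, rfl⟩]
    at this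
  simpa using this

theorem not_starIsoX1_and_starIsoS2 (M : Fin d → Matrix ι ι K) :
    ¬ (StarIsoX1 (adjPair M) ∧ StarIsoS2 (adjPair M)) := by
  rintro ⟨h1, h2⟩
  have h := (starIsoX1_iff.1 h1).mul_comm (starIsoS2_iff.1 h2) mul_comm
    !![0, 1; 0, 0] !![0, 0; 1, 0]
  simpa using congrFun (congrFun h 0) 0

theorem starIsoX1_BmatEP {a lam mu : K} (h2 : (2 : K) ≠ 0) (hmu : mu ≠ 0) :
    StarIsoX1 (adjPair (BmatEP a lam mu)) := by
  have key : ∀ p : adjPair (BmatEP a lam mu), p.val =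
      (Matrix.fromBlocks (p.val.1 (.inl 0) (.inl 0) • 1) 0 0 (p.val.1 (.inr 0) (.inr 0) • 1),
      Matrix.fromBlocks (p.val.1 (.inr 0) (.inr 0) • 1) 0 0
        (p.val.1 (.inl 0) (.inl 0) • 1)) := by
    rintro ⟨⟨A, C⟩, hp⟩
    obtain ⟨q, r, s, t, hq, hr, h1, h2'⟩ := mem_adjPair_BmatEP_iff.1 hp
    have hq0 : q = 0 := by
      have : 2 * mu * q = 0 := by linear_combination hq
      simpa [h2, hmu] using this
    have hr0 : r = 0 := by
      have : 2 * mu * r = 0 := by linear_combination hr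
      simpa [h2, hmu] using this
    simp only at h1 h2'
    simp [h1, h2', hq0, hr0]
  let e : adjPair (BmatEP a lam mu) ≃ K × K :=
    { toFun := fun p => (p.val.1 (.inl 0) (.inl 0), p.val.1 (.inr 0) (.inr 0))
      invFun := fun x => ⟨(Matrix.fromBlocks (x.1 • 1) 0 0 (x.2 • 1),
          Matrix.fromBlocks (x.2 • 1) 0 0 (x.1 • 1)),
        mem_adjPair_BmatEP_iff.2 ⟨0, 0, x.1, x.2, by simp, by simp, by simp, by simp⟩⟩
      left_inv := fun p => Subtype.ext (key p).symm
      right_inv := fun x => by simp }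
  refine ⟨e, ?_, ?_, ?_, ?_, ?_⟩
  · intro x y z h
    simp [e, h]
  · intro c x z h
    simp [e, h]
  · rintro x y z ⟨h, -⟩
    have hx := congrArg Prod.fst (key x)
    have hy := congrArg Prod.fst (key y)
    simp only [e, Equiv.coe_fn_mk, h, Prod.mk_mul_mk, Prod.mk.injEq]
    rw [hx, hy]
    simp [Matrix.fromBlocks_multiply, mul_comm]
  · intro z h
    simp [e, h]
  · rintro x z ⟨h, -⟩
    have hx := congrArg Prod.snd (key x)
    simp only [e, Equiv.coe_fn_mk, h, Prod.swap_prod_mk]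
    rw [hx]
    simp

theorem symplectic_involution_fin_two (p q r s : K) :
    !![0, 1; -1, 0] * !![p, q; r, s]ᵀ * !![0, -1; 1, 0] = !![s, -q; -r, p] := by
  have h : !![p, q; r, s]ᵀ = !![p, r; q, s] := by
    ext i j
    fin_cases i <;> fin_cases j <;> rfl
  rw [h]
  simp

theorem starIsoS2_BmatEP {a lam : K} : StarIsoS2 (adjPair (BmatEP a lam 0)) := by
  have key : ∀ p : adjPair (BmatEP a lam 0), p.val =
      (Matrix.fromBlocks (p.val.1 (.inl 0) (.inl 0) • 1) (p.val.1 (.inl 0) (.inr 0) • 1)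
        (p.val.1 (.inr 0) (.inl 0) • 1) (p.val.1 (.inr 0) (.inr 0) • 1),
      Matrix.fromBlocks (p.val.1 (.inr 0) (.inr 0) • 1) (-p.val.1 (.inl 0) (.inr 0) • 1)
        (-p.val.1 (.inr 0) (.inl 0) • 1) (p.val.1 (.inl 0) (.inl 0) • 1)) := by
    rintro ⟨⟨A, C⟩, hp⟩
    obtain ⟨q, r, s, t, hq, hr, h1, h2'⟩ := mem_adjPair_BmatEP_iff.1 hp
    simp only at h1 h2'
    simp [h1, h2']
  let e : adjPair (BmatEP a lam 0) ≃ Matrix (Fin 2) (Fin 2) K :=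
    { toFun := fun p => !![p.val.1 (.inl 0) (.inl 0), p.val.1 (.inl 0) (.inr 0);
        p.val.1 (.inr 0) (.inl 0), p.val.1 (.inr 0) (.inr 0)]
      invFun := fun x => ⟨(Matrix.fromBlocks (x 0 0 • 1) (x 0 1 • 1) (x 1 0 • 1) (x 1 1 • 1),
          Matrix.fromBlocks (x 1 1 • 1) (-x 0 1 • 1) (-x 1 0 • 1) (x 0 0 • 1)),
        mem_adjPair_BmatEP_iff.2 ⟨x 0 1, x 1 0, x 0 0, x 1 1, by simp, by simp, rfl, rfl⟩⟩
      left_inv := fun p => Subtype.ext (key p).symm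
      right_inv := fun x => by
        ext i j
        fin_cases i <;> fin_cases j <;> simp }
  refine ⟨e, ?_, ?_, ?_, ?_, ?_⟩
  · intro x y z h
    simp [e, h]
  · intro c x z h
    simp [e, h]
  · rintro x y z ⟨h, -⟩
    have hx := congrArg Prod.fst (key x)
    have hy := congrArg Prod.fst (key y)
    simp only [e, Equiv.coe_fn_mk, h]
    rw [hx, hy]
    simp [Matrix.fromBlocks_multiply, mul_comm]
  · intro z h
    simp [e, h, Matrix.one_fin_two]
  · rintro x z ⟨h, -⟩
    have hx := congrArg Prod.snd (key x)
    simp only [e, Equiv.coe_fn_mk, h]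
    rw [hx]
    rw [symplectic_involution_fin_two]
    simp

end Adjoint

/-! ### Baer groups and semilinear transport -/

section Transport

variable {K : Type*} [Field K] {ι : Type*} [Fintype ι] {d : ℕ}

theorem matTensor_add_left (B : Fin d → Matrix ι ι K) (u v w : ι → K) :
    matTensor B (u + v) w = matTensor B u w + matTensor B v w := by
  ext k
  simp [matTensor, add_dotProduct]

theorem matTensor_smul_left (B : Fin d → Matrix ι ι K) (c : K) (u v : ι → K) :
    matTensor B (c • u) v = c • matTensor B u v := by
  ext k
  simp [matTensor, smul_dotProduct]

theorem matTensor_smul_right (B : Fin d → Matrix ι ι K) (c : K) (u v : ι → K) :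
    matTensor B u (c • v) = c • matTensor B u v := by
  ext k
  simp [matTensor, Matrix.mulVec_smul, dotProduct_smul]

theorem matTensor_skew {B : Fin d → Matrix ι ι K} (hB : ∀ k, (B k)ᵀ = -B k) (u v : ι → K) :
    matTensor B u v = -matTensor B v u := by
  ext k
  have : u ⬝ᵥ (B k).mulVec v = v ⬝ᵥ (B k)ᵀ.mulVec u := by
    rw [Matrix.mulVec_transpose, dotProduct_comm v, Matrix.dotProduct_mulVec]
  simp [matTensor, this, hB, Matrix.neg_mulVec]

/-- The tensor represented by `B` has trivial radical. -/
def MatNondegenerate (B : Fin d → Matrix ι ι K) : Prop :=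
  ∀ u, (∀ v, matTensor B u v = 0) → u = 0

theorem MatNondegenerate.eq_of_forall {B : Fin d → Matrix ι ι K} (h : MatNondegenerate B)
    {u u' : ι → K} (huu : ∀ v, matTensor B u v = matTensor B u' v) : u = u' := by
  rw [← sub_eq_zero]
  refine h _ fun v => ?_
  have := matTensor_add_left B (u - u') u' v
  rw [sub_add_cancel, huu] at this
  simpa using this.symm

theorem MatNondegenerate.exists_linearMap {B : Fin d → Matrix ι ι K} (h : MatNondegenerate B)
    {α β : (ι → K) → ι → K} (hαβ : ∀ u v, matTensor B (α u) v = matTensor B u (β v)) :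
    ∃ f : (ι → K) →ₗ[K] ι → K, ∀ u, f u = α u :=
  ⟨{ toFun := α
     map_add' := fun u v => h.eq_of_forall fun w => by
      rw [hαβ, matTensor_add_left, matTensor_add_left, hαβ, hαβ]
     map_smul' := fun c u => h.eq_of_forall fun w => by
      rw [hαβ, matTensor_smul_left, RingHom.id_apply, matTensor_smul_left, hαβ] }, fun _ => rfl⟩

theorem baerMul_comm_iff (h2 : (2 : K) ≠ 0) {B : Fin d → Matrix ι ι K} (hB : ∀ k, (B k)ᵀ = -B k)
    (x y : (ι → K) × (Fin d → K)) : baerMul (K := K) (matTensor B) x y =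
      baerMul (K := K) (matTensor B) y x ↔ matTensor B x.1 y.1 = 0 := by
  rw [baerMul, baerMul, matTensor_skew hB y.1, Prod.mk.injEq, add_comm x.1, add_comm x.2]
  simp only [true_and, add_right_inj, smul_neg]
  rw [← smul_neg, smul_right_inj (inv_ne_zero h2)]
  constructor
  · intro h
    have : (2 : K) • matTensor B x.1 y.1 = 0 := by
      rw [two_smul]
      nth_rewrite 1 [h]
      simp
    simpa [h2] using this
  · intro h
    simp [h]

/-- An isomorphism of Baer groups of nondegenerate tensors induces an isometry up to additive
isomorphisms. -/
theorem exists_addEquiv_of_baer {κ : Type*} [Fintype κ] {d' : ℕ} (h2 : (2 : K) ≠ 0)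
    {B : Fin d → Matrix ι ι K} {B' : Fin d' → Matrix κ κ K}
    (hB : ∀ k, (B k)ᵀ = -B k) (hB' : ∀ k, (B' k)ᵀ = -B' k)
    (h : MatNondegenerate B) (h' : MatNondegenerate B')
    (e : (ι → K) × (Fin d → K) ≃ (κ → K) × (Fin d' → K))
    (he : ∀ x y, e (baerMul (K := K) (matTensor B) x y) =
      baerMul (K := K) (matTensor B') (e x) (e y)) :
    ∃ φ : (ι → K) ≃+ (κ → K), ∀ u v u' v',
      matTensor B u v = matTensor B u' v' ↔
        matTensor B' (φ u) (φ v) = matTensor B' (φ u') (φ v') := by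
  have t0 (v : ι → K) : matTensor B 0 v = 0 := by
    simpa using matTensor_smul_left B 0 0 v
  have t0' (v : κ → K) : matTensor B' 0 v = 0 := by
    simpa using matTensor_smul_left B' 0 0 v
  have s0 (v : ι → K) : matTensor B v 0 = 0 := by
    simpa using matTensor_smul_right B 0 v 0
  have s0' (v : κ → K) : matTensor B' v 0 = 0 := by
    simpa using matTensor_smul_right B' 0 v 0
  have comm := baerMul_comm_iff h2 hB
  have comm' := baerMul_comm_iff h2 hB'
  have center (x : (ι → K) × (Fin d → K)) : (e x).1 = 0 ↔ x.1 = 0 := by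
    constructor
    · intro hx
      refine h _ fun v => ?_
      rw [← comm x (v, 0)]
      apply e.injective
      rw [he, he, comm', hx, t0']
    · intro hx
      refine h' _ fun v => ?_
      rw [← comm' (e x) (v, 0)]
      apply e.symm.injective
      obtain ⟨y, hy⟩ := e.surjective (v, 0)
      rw [← hy, ← he, ← he, e.symm_apply_apply, e.symm_apply_apply, comm, hx, t0]
  have fst (x : (ι → K) × (Fin d → K)) : (e x).1 = (e (x.1, 0)).1 := by
    have := he (x.1, 0) (0, x.2)
    have h1 : baerMul (K := K) (matTensor B) (x.1, 0) (0, x.2) = x := by simp [baerMul, s0]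
    rw [h1] at this
    rw [this]
    simp [baerMul, (center (0, x.2)).2 rfl]
  have hψ (u v : ι → K) : e (0, matTensor B u v) = (0, matTensor B' (e (u, 0)).1 (e (v, 0)).1) := by
    have h1 := he (u, 0) (v, 0)
    have h2' := he (baerMul (K := K) (matTensor B) (v, 0) (u, 0)) (0, matTensor B u v)
    have h3 : baerMul (K := K) (matTensor B) (baerMul (K := K) (matTensor B) (v, 0) (u, 0))
        (0, matTensor B u v) = baerMul (K := K) (matTensor B) (u, 0) (v, 0) := by
      simp only [baerMul, s0, matTensor_skew hB v u, add_comm v u, Prod.mk.injEq, add_zero,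
        zero_add, true_and, smul_zero]
      have : matTensor B u v = (2 : K)⁻¹ • (2 : K) • matTensor B u v := by
        rw [smul_smul, inv_mul_cancel₀ h2, one_smul]
      nth_rewrite 2 [this]
      rw [two_smul, smul_add, smul_neg]
      abel
    rw [h3, h1, he] at h2'
    have hc := (center (0, matTensor B u v)).2 rfl
    have h4 := congrArg Prod.snd h2'
    simp only [baerMul, hc, s0', smul_zero, add_zero] at h4
    refine Prod.ext hc ?_
    rw [matTensor_skew hB' (e (v, 0)).1 (e (u, 0)).1] at h4
    have : matTensor B' (e (u, 0)).1 (e (v, 0)).1 =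
        (2 : K)⁻¹ • (2 : K) • matTensor B' (e (u, 0)).1 (e (v, 0)).1 := by
      rw [smul_smul, inv_mul_cancel₀ h2, one_smul]
    rw [this, two_smul, smul_add]
    rw [smul_neg] at h4
    linear_combination -h4
  let φ₀ : (ι → K) →+ (κ → K) :=
    AddMonoidHom.mk' (fun v => (e (v, 0)).1) fun u v => by
      have := congrArg Prod.fst (he (u, 0) (v, 0))
      rw [fst] at this
      simpa [baerMul] using this
  have bij : Function.Bijective φ₀ := by
    constructor
    · rw [injective_iff_map_eq_zero]
      intro v hv
      exact (center (v, 0)).1 hv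
    · intro v
      obtain ⟨y, hy⟩ := e.surjective (v, 0)
      refine ⟨y.1, ?_⟩
      have := fst y
      rw [hy] at this
      exact this.symm
  refine ⟨AddEquiv.ofBijective φ₀ bij, fun u v u' v' => ?_⟩
  have h1 := hψ u v
  have h2' := hψ u' v'
  change _ ↔ matTensor B' (e (u, 0)).1 (e (v, 0)).1 = matTensor B' (e (u', 0)).1 (e (v', 0)).1
  constructor
  · intro hh
    rw [hh, h2'] at h1
    exact (congrArg Prod.snd h1).symm
  · intro hh
    rw [hh, ← h2'] at h1
    exact congrArg Prod.snd (e.injective h1)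

variable [DecidableEq ι]

theorem mem_adjPair_iff {B : Fin d → Matrix ι ι K} {p : Matrix ι ι K × Matrix ι ι K} :
    p ∈ adjPair B ↔ ∀ u v, matTensor B (p.1 *ᵥ u) v = matTensor B u (p.2 *ᵥ v) := by
  constructor
  · intro h u v
    ext k
    have hk : p.1ᵀ * B k = B k * p.2 := h k
    simp only [matTensor]
    rw [Matrix.mulVec_mulVec, ← hk, ← Matrix.mulVec_mulVec, Matrix.dotProduct_mulVec _ p.1ᵀ,
      Matrix.vecMul_transpose]
  · intro h k
    refine Matrix.ext_of_mulVec_single fun j => ?_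
    refine dotProduct_eq _ _ fun u => ?_
    have := congrFun (h u (Pi.single j 1)) k
    simp only [matTensor] at this
    rw [dotProduct_comm _ u, dotProduct_comm _ u, ← Matrix.mulVec_mulVec, ← Matrix.mulVec_mulVec,
      Matrix.dotProduct_mulVec _ p.1ᵀ, Matrix.vecMul_transpose, this]

/-- Mutually adjoint maps are given by an element of the adjoint algebra. -/
theorem MatNondegenerate.exists_mem_adjPair {B : Fin d → Matrix ι ι K} (h : MatNondegenerate B)
    (hB : ∀ k, (B k)ᵀ = -B k) {α β : (ι → K) → ι → K}
    (hαβ : ∀ u v, matTensor B (α u) v = matTensor B u (β v)) :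
    ∃ p ∈ adjPair B, (∀ u, p.1 *ᵥ u = α u) ∧ ∀ u, p.2 *ᵥ u = β u := by
  obtain ⟨f, hf⟩ := h.exists_linearMap hαβ
  obtain ⟨g, hg⟩ := h.exists_linearMap (α := β) (β := α) fun u v => by
    rw [matTensor_skew hB, ← hαβ, matTensor_skew hB, neg_neg]
  have h1 (u) : LinearMap.toMatrix' f *ᵥ u = α u := by rw [LinearMap.toMatrix'_mulVec, hf]
  have h2 (u) : LinearMap.toMatrix' g *ᵥ u = β u := by rw [LinearMap.toMatrix'_mulVec, hg]
  refine ⟨(LinearMap.toMatrix' f, LinearMap.toMatrix' g), mem_adjPair_iff.2 fun u v => ?_, h1, h2⟩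
  rw [h1, h2, hαβ]

/-- If all self-adjoint elements of the target are scalar, an additive isometry is semilinear. -/
theorem exists_semilinear {κ : Type*} [Fintype κ] [DecidableEq κ] [Nonempty κ] {d' : ℕ}
    (hcard : Fintype.card ι = Fintype.card κ)
    {B : Fin d → Matrix ι ι K} {B' : Fin d' → Matrix κ κ K}
    (hB' : ∀ k, (B' k)ᵀ = -B' k) (h' : MatNondegenerate B')
    (hself : ∀ A, (A, A) ∈ adjPair B' → ∃ c : K, A = c • 1)
    (φ : (ι → K) ≃+ (κ → K)) (hφ : ∀ u v u' v',
      matTensor B u v = matTensor B u' v' ↔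
        matTensor B' (φ u) (φ v) = matTensor B' (φ u') (φ v')) :
    ∃ σ : K ≃+* K, ∀ c u, φ (c • u) = σ c • φ u := by
  have hex (c : K) : ∃ c' : K, ∀ u, φ (c • u) = c' • φ u := by
    obtain ⟨p, hp, hp1, hp2⟩ := h'.exists_mem_adjPair hB'
      (α := fun u => φ (c • φ.symm u)) (β := fun u => φ (c • φ.symm u)) fun u v => by
        have := (hφ (c • φ.symm u) (φ.symm v) (φ.symm u) (c • φ.symm v)).1
          (by rw [matTensor_smul_left, matTensor_smul_right])
        simpa using this
    have hpp : p.1 = p.2 := Matrix.ext_of_mulVec_single fun j => by rw [hp1, hp2]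
    obtain ⟨c', hc'⟩ := hself p.1 (by nth_rewrite 2 [hpp]; exact hp)
    refine ⟨c', fun u => ?_⟩
    have := hp1 (φ u)
    rw [hc', Matrix.smul_mulVec, Matrix.one_mulVec, φ.symm_apply_apply] at this
    exact this.symm
  choose σ hσ using hex
  obtain ⟨w, hw⟩ := exists_ne (0 : κ → K)
  have cancel {a b : K} (hab : a • w = b • w) : a = b := smul_left_injective K hw hab
  have hσ' (c : K) : φ (c • φ.symm w) = σ c • w := by rw [hσ, φ.apply_symm_apply]
  let σ₀ : K →+* K :=
    { toFun := σ
      map_one' := cancel <| by rw [← hσ']; simp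
      map_zero' := cancel <| by rw [← hσ']; simp
      map_mul' := fun a b => cancel <| by
        rw [← hσ', mul_smul, hσ, hσ', mul_smul]
      map_add' := fun a b => cancel <| by
        rw [← hσ', add_smul, map_add, hσ', hσ', add_smul] }
  have expand (u : ι → K) : φ u = ∑ i, σ (u i) • φ (Pi.single i 1) := by
    conv_lhs => rw [pi_eq_sum_univ' u]
    rw [map_sum]
    refine Finset.sum_congr rfl fun i _ => ?_
    rw [← hσ]
  have hsurj : Function.Surjective σ₀ := by
    have hspan : ⊤ ≤ Submodule.span K (Set.range fun i => φ (Pi.single i 1)) := fun v _ => by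
      rw [← φ.apply_symm_apply v, expand]
      exact Submodule.sum_mem _ fun i _ =>
        Submodule.smul_mem _ _ (Submodule.subset_span ⟨i, rfl⟩)
    have hli := linearIndependent_of_top_le_span_of_card_eq_finrank hspan (by simp [hcard])
    have hne : Nonempty ι := Fintype.card_pos_iff.1 (hcard ▸ Fintype.card_pos)
    obtain ⟨i₀⟩ := hne
    intro c
    have h1 := expand (φ.symm (c • φ (Pi.single i₀ 1)))
    rw [φ.apply_symm_apply] at h1
    have h2 : ∑ i, (σ (φ.symm (c • φ (Pi.single i₀ 1)) i) - Pi.single (M := fun _ => K) i₀ c i) •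
        φ (Pi.single i 1) = 0 := by
      simp only [sub_smul, Finset.sum_sub_distrib]
      rw [← h1, sub_eq_zero, Finset.sum_eq_single i₀]
      · simp
      · intro i _ hi
        simp [Pi.single_eq_of_ne hi]
      · simp
    have h3 := Fintype.linearIndependent_iff.1 hli _ h2 i₀
    rw [Pi.single_eq_same, sub_eq_zero] at h3
    exact ⟨_, h3⟩
  exact ⟨RingEquiv.ofBijective σ₀ ⟨σ₀.injective, hsurj⟩, hσ⟩

theorem StarIsoTo.of_semilinear {κ : Type*} [Fintype κ] [DecidableEq κ] {d' : ℕ}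
    {B : Fin d → Matrix ι ι K} {B' : Fin d' → Matrix κ κ K}
    (hB : ∀ k, (B k)ᵀ = -B k) (hB' : ∀ k, (B' k)ᵀ = -B' k)
    (h : MatNondegenerate B) (h' : MatNondegenerate B')
    (φ : (ι → K) ≃+ (κ → K)) (hφ : ∀ u v u' v',
      matTensor B u v = matTensor B u' v' ↔
        matTensor B' (φ u) (φ v) = matTensor B' (φ u') (φ v'))
    (σ : K ≃+* K) (hσ : ∀ c u, φ (c • u) = σ c • φ u)
    {D : Type*} [Ring D] [SMul K D] {st : D → D} (hD : StarIsoTo (adjPair B') D st)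
    (τ : D ≃+* D) (hτ : ∀ (c : K) (x : D), τ (σ c • x) = c • τ x) (hst : ∀ x, τ (st x) = st (τ x)) :
    StarIsoTo (adjPair B) D st := by
  have hex (p : adjPair B) : ∃ q : adjPair B', (∀ u, q.val.1 *ᵥ φ u = φ (p.val.1 *ᵥ u)) ∧
      ∀ u, q.val.2 *ᵥ φ u = φ (p.val.2 *ᵥ u) := by
    obtain ⟨q, hq, hq1, hq2⟩ := h'.exists_mem_adjPair hB'
      (α := fun u => φ (p.val.1 *ᵥ φ.symm u)) (β := fun u => φ (p.val.2 *ᵥ φ.symm u)) fun u v => by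
        simpa using (hφ _ (φ.symm v) (φ.symm u) _).1 (mem_adjPair_iff.1 p.2 (φ.symm u) (φ.symm v))
    exact ⟨⟨q, hq⟩, fun u => by simp [hq1], fun u => by simp [hq2]⟩
  have hex' (q : adjPair B') : ∃ p : adjPair B, (∀ u, q.val.1 *ᵥ φ u = φ (p.val.1 *ᵥ u)) ∧
      ∀ u, q.val.2 *ᵥ φ u = φ (p.val.2 *ᵥ u) := by
    obtain ⟨p, hp, hp1, hp2⟩ := h.exists_mem_adjPair hB
      (α := fun u => φ.symm (q.val.1 *ᵥ φ u)) (β := fun u => φ.symm (q.val.2 *ᵥ φ u)) fun u v => by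
        rw [hφ]
        simpa using mem_adjPair_iff.1 q.2 (φ u) (φ v)
    exact ⟨⟨p, hp⟩, fun u => by simp [hp1], fun u => by simp [hp2]⟩
  have ext' {M N : Matrix κ κ K} (hMN : ∀ u, M *ᵥ φ u = N *ᵥ φ u) : M = N :=
    Matrix.ext_of_mulVec_single fun j => by
      simpa using hMN (φ.symm (Pi.single j 1))
  have ext {M N : Matrix ι ι K} (hMN : ∀ u, φ (M *ᵥ u) = φ (N *ᵥ u)) : M = N :=
    Matrix.ext_of_mulVec_single fun j => φ.injective (hMN _)
  choose F hF1 hF2 using hex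
  have hF : Function.Bijective F := by
    constructor
    · intro p p' hpp
      refine Subtype.ext (Prod.ext (ext fun u => ?_) (ext fun u => ?_))
      · rw [← hF1, ← hF1, hpp]
      · rw [← hF2, ← hF2, hpp]
    · intro q
      obtain ⟨p, hp1, hp2⟩ := hex' q
      refine ⟨p, Subtype.ext (Prod.ext (ext' fun u => ?_) (ext' fun u => ?_))⟩
      · rw [hF1, hp1]
      · rw [hF2, hp2]
  obtain ⟨e, hadd, hsmul, hmul, hone, hstar⟩ := hD
  refine ⟨((Equiv.ofBijective F hF).trans e).trans τ.toEquiv, ?_, ?_, ?_, ?_, ?_⟩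
  · intro x y z hz
    change τ (e (F z)) = τ (e (F x)) + τ (e (F y))
    rw [← map_add, hadd (F x) (F y) (F z)]
    refine Prod.ext (ext' fun u => ?_) (ext' fun u => ?_)
    · simp [hF1, hz, Matrix.add_mulVec]
    · simp [hF2, hz, Matrix.add_mulVec]
  · intro c x z hz
    change τ (e (F z)) = c • τ (e (F x))
    rw [← hτ, hsmul (σ c) (F x) (F z)]
    refine Prod.ext (ext' fun u => ?_) (ext' fun u => ?_)
    · simp [hF1, hz, Matrix.smul_mulVec, hσ]
    · simp [hF2, hz, Matrix.smul_mulVec, hσ]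
  · rintro x y z ⟨hz1, hz2⟩
    change τ (e (F z)) = τ (e (F x)) * τ (e (F y))
    rw [← map_mul, hmul (F x) (F y) (F z)]
    refine ⟨ext' fun u => ?_, ext' fun u => ?_⟩
    · rw [← Matrix.mulVec_mulVec, hF1, hF1, hF1, hz1, Matrix.mulVec_mulVec]
    · rw [← Matrix.mulVec_mulVec, hF2, hF2, hF2, hz2, Matrix.mulVec_mulVec]
  · intro z hz
    change τ (e (F z)) = 1
    rw [hone (F z), map_one]
    refine Prod.ext (ext' fun u => ?_) (ext' fun u => ?_)
    · simp [hF1, hz]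
    · simp [hF2, hz]
  · rintro x z ⟨hz1, hz2⟩
    change τ (e (F z)) = st (τ (e (F x)))
    rw [← hst, hstar (F x) (F z)]
    refine ⟨ext' fun u => ?_, ext' fun u => ?_⟩
    · rw [hF1, hF2, hz1]
    · rw [hF1, hF2, hz2]

end Transport

/-! ### From the Baer group to the adjoint algebra -/

section Converse

variable {K : Type*} [Field K]

theorem matTensor_single_right {ι : Type*} [Fintype ι] [DecidableEq ι] {d : ℕ}
    (B : Fin d → Matrix ι ι K) (u : ι → K) (j : ι) (k : Fin d) :
    matTensor B u (Pi.single j 1) k = (u ᵥ* B k) j := by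
  simp [matTensor, Matrix.vecMul]
  rfl

theorem matNondegenerate_of_det_ne_zero {ι : Type*} [Fintype ι] [DecidableEq ι] {d : ℕ}
    {B : Fin d → Matrix ι ι K} (h : (polyMat B).det ≠ 0) : MatNondegenerate B := fun u hu => by
  have hk (k : Fin d) : u ᵥ* B k = 0 := by
    ext j
    rw [← matTensor_single_right, hu]
    rfl
  have h0 : (fun i => (MvPolynomial.C (u i) : MvPolynomial (Fin d) K)) ᵥ* polyMat B = 0 := by
    ext1 j
    simp only [Matrix.vecMul, dotProduct, polyMat, Matrix.of_apply, Finset.mul_sum, Pi.zero_apply]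
    rw [Finset.sum_comm]
    refine Finset.sum_eq_zero fun k _ => ?_
    have := congrFun (hk k) j
    simp only [Matrix.vecMul, dotProduct, Pi.zero_apply] at this
    simp only [← mul_assoc, ← MvPolynomial.C_mul, ← Finset.sum_mul, ← map_sum, this, map_zero,
      zero_mul]
  ext i
  have := congrFun (Matrix.eq_zero_of_vecMul_eq_zero h h0) i
  simpa using this

theorem BmatEP_skew (a lam mu : K) (k : Fin 3) : (BmatEP a lam mu k)ᵀ = -BmatEP a lam mu k := by
  simp [BmatEP, Matrix.fromBlocks_transpose, Matrix.fromBlocks_neg]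

theorem matNondegenerate_BmatEP (a lam mu : K) : MatNondegenerate (BmatEP a lam mu) :=
  fun u hu => by
  have h0 : ∀ j, (u ᵥ* BmatEP a lam mu 0) j = 0 := fun j => by
    rw [← matTensor_single_right, hu]
    rfl
  simp only [Sum.forall, Fin.forall_fin_succ, BmatEP, Jmat, Matrix.vecMul, dotProduct,
    Fintype.sum_sum_type, Fin.sum_univ_succ] at h0
  simp at h0
  ext i
  rcases i with i | i <;> fin_cases i <;> simp <;> grind

theorem BmatEP_selfAdjoint {a lam mu : K} (h2 : (2 : K) ≠ 0)
    (A : Matrix (Fin 3 ⊕ Fin 3) (Fin 3 ⊕ Fin 3) K) (hA : (A, A) ∈ adjPair (BmatEP a lam mu)) :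
    ∃ c : K, A = c • 1 := by
  obtain ⟨q, r, s, t, -, -, h1, h1'⟩ := mem_adjPair_BmatEP_iff.1 hA
  simp only at h1 h1'
  rw [h1, Matrix.fromBlocks_inj] at h1'
  obtain ⟨e1, e2, e3, -⟩ := h1'
  have e1' := congrFun (congrFun e1 0) 0
  have e2' := congrFun (congrFun e2 0) 0
  have e3' := congrFun (congrFun e3 0) 0
  simp at e1' e2' e3'
  have hq : q = 0 := by
    have : 2 * q = 0 := by linear_combination e2'
    simpa [h2] using this
  have hr : r = 0 := by
    have : 2 * r = 0 := by linear_combination e3'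
    simpa [h2] using this
  refine ⟨s, ?_⟩
  rw [h1, hq, hr, ← e1', ← Matrix.fromBlocks_one, Matrix.fromBlocks_smul]
  simp

theorem starIsoTo_of_baer (h2 : (2 : K) ≠ 0) {B : Fin 3 → Matrix (Fin 6) (Fin 6) K}
    (hskew : ∀ k, (B k)ᵀ = -(B k)) (hdet : (polyMat B).det ≠ 0) {a lam mu : K}
    (hiso : ∃ e : (Fin 6 → K) × (Fin 3 → K) ≃ ((Fin 3 ⊕ Fin 3) → K) × (Fin 3 → K),
      ∀ x y, e (baerMul (K := K) (matTensor B) x y) =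
        baerMul (K := K) (epTensor a lam mu) (e x) (e y))
    {D : Type*} [Ring D] [SMul K D] {st : D → D} (hD : StarIsoTo (adjPair (BmatEP a lam mu)) D st)
    (τ : (K ≃+* K) → D ≃+* D) (hτ : ∀ (σ : K ≃+* K) (c : K) (x : D), τ σ (c • x) = σ c • τ σ x)
    (hst : ∀ σ x, τ σ (st x) = st (τ σ x)) :
    StarIsoTo (adjPair B) D st := by
  obtain ⟨e, he⟩ := hiso
  have hB := matNondegenerate_of_det_ne_zero hdet
  have hB' := matNondegenerate_BmatEP a lam mu
  obtain ⟨φ, hφ⟩ := exists_addEquiv_of_baer h2 hskew (BmatEP_skew a lam mu) hB hB' e he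
  obtain ⟨σ, hσ⟩ := exists_semilinear (by simp) (BmatEP_skew a lam mu) hB' (BmatEP_selfAdjoint h2)
    φ hφ
  exact hD.of_semilinear hskew (BmatEP_skew a lam mu) hB hB' φ hφ σ hσ (τ σ.symm)
    (fun c x => by simp [hτ]) (hst σ.symm)

theorem starIsoX1_of_baer (h2 : (2 : K) ≠ 0) {B : Fin 3 → Matrix (Fin 6) (Fin 6) K}
    (hskew : ∀ k, (B k)ᵀ = -(B k)) (hdet : (polyMat B).det ≠ 0) {a lam mu : K} (hmu : mu ≠ 0)
    (hiso : ∃ e : (Fin 6 → K) × (Fin 3 → K) ≃ ((Fin 3 ⊕ Fin 3) → K) × (Fin 3 → K),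
      ∀ x y, e (baerMul (K := K) (matTensor B) x y) =
        baerMul (K := K) (epTensor a lam mu) (e x) (e y)) :
    StarIsoX1 (adjPair B) :=
  starIsoX1_iff.2 <| starIsoTo_of_baer h2 hskew hdet hiso
    (starIsoX1_iff.1 (starIsoX1_BmatEP h2 hmu)) (fun σ => RingEquiv.prodCongr σ σ)
    (fun σ c x => by ext <;> simp) (fun σ x => by ext <;> simp)

theorem starIsoS2_of_baer (h2 : (2 : K) ≠ 0) {B : Fin 3 → Matrix (Fin 6) (Fin 6) K}
    (hskew : ∀ k, (B k)ᵀ = -(B k)) (hdet : (polyMat B).det ≠ 0) {a lam : K}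
    (hiso : ∃ e : (Fin 6 → K) × (Fin 3 → K) ≃ ((Fin 3 ⊕ Fin 3) → K) × (Fin 3 → K),
      ∀ x y, e (baerMul (K := K) (matTensor B) x y) =
        baerMul (K := K) (epTensor a lam 0) (e x) (e y)) :
    StarIsoS2 (adjPair B) :=
  starIsoS2_iff.2 <| starIsoTo_of_baer h2 hskew hdet hiso
    (starIsoS2_iff.1 starIsoS2_BmatEP) (fun σ => σ.mapMatrix)
    (fun σ c x => by ext; simp) (fun σ x => by
      ext i j
      fin_cases i <;> fin_cases j <;>
        simp [Matrix.mul_apply, Fin.sum_univ_two, Matrix.vecMul, dotProduct])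

end Converse

/-! ### Determinantal representations of Weierstrass cubics -/

section DeterminantalRepresentation

variable {K : Type*} [Field K]

theorem ternary_cubic_coeff_eq_zero (h2 : (2 : K) ≠ 0) {c₁ c₂ c₃ c₄ c₅ c₆ c₇ c₈ c₉ c₀ : K}
    (h : ∀ x y z : K, c₁ * x ^ 3 + c₂ * y ^ 3 + c₃ * z ^ 3 + c₄ * (x ^ 2 * y) + c₅ * (x ^ 2 * z) +
      c₆ * (x * y ^ 2) + c₇ * (y ^ 2 * z) + c₈ * (x * z ^ 2) + c₉ * (y * z ^ 2) +
      c₀ * (x * y * z) = 0) :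
    c₁ = 0 ∧ c₂ = 0 ∧ c₃ = 0 ∧ c₄ = 0 ∧ c₅ = 0 ∧ c₆ = 0 ∧ c₇ = 0 ∧ c₈ = 0 ∧ c₉ = 0 ∧ c₀ = 0 := by
  have e1 := h 1 0 0
  have e2 := h 0 1 0
  have e3 := h 0 0 1
  have e4 := h 1 1 0
  have e5 := h 1 (-1) 0
  have e6 := h 1 0 1
  have e7 := h 1 0 (-1)
  have e8 := h 0 1 1
  have e9 := h 0 1 (-1)
  have e0 := h 1 1 1
  ring_nf at e1 e2 e3 e4 e5 e6 e7 e8 e9 e0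
  have aux {t : K} (ht : 2 * t = 0) : t = 0 := (mul_eq_zero.1 ht).resolve_left h2
  have f4 : c₄ = 0 := aux (by linear_combination e4 - e5 - 2 * e2)
  have f6 : c₆ = 0 := aux (by linear_combination e4 + e5 - 2 * e1)
  have f5 : c₅ = 0 := aux (by linear_combination e6 - e7 - 2 * e3)
  have f8 : c₈ = 0 := aux (by linear_combination e6 + e7 - 2 * e1)
  have f7 : c₇ = 0 := aux (by linear_combination e8 - e9 - 2 * e3)
  have f9 : c₉ = 0 := aux (by linear_combination e8 + e9 - 2 * e2)
  exact ⟨e1, e2, e3, f4, f5, f6, f7, f8, f9,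
    by linear_combination e0 - e1 - e2 - e3 - f4 - f5 - f6 - f7 - f8 - f9⟩

/-- The pencil of matrices `M` has determinant `c * (y²z - x³ - axz² - bz³)`. -/
def IsWeierstrassRep (M : Fin 3 → Matrix (Fin 3) (Fin 3) K) (a b c : K) : Prop :=
  ∀ x y z : K, (x • M 0 + y • M 1 + z • M 2).det =
    c * (y ^ 2 * z - x ^ 3 - a * x * z ^ 2 - b * z ^ 3)

/-- The pencil of matrices `M` is equivalent to `Jmat a lam mu` for some affine point `(lam, mu)`
of `y² = x³ + ax + b`. -/
def IsJmatEquiv (M : Fin 3 → Matrix (Fin 3) (Fin 3) K) (a b : K) : Prop :=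
  ∃ (X Y : Matrix (Fin 3) (Fin 3) K) (lam mu : K), X.det ≠ 0 ∧ Y.det ≠ 0 ∧
    mu ^ 2 = lam ^ 3 + a * lam + b ∧ ∀ k, X * M k * Y = Jmat a lam mu k

theorem IsWeierstrassRep.mul {M : Fin 3 → Matrix (Fin 3) (Fin 3) K} {a b c : K}
    (h : IsWeierstrassRep M a b c) (X Y : Matrix (Fin 3) (Fin 3) K) :
    IsWeierstrassRep (fun k => X * M k * Y) a b (X.det * Y.det * c) := fun x y z => by
  have : x • (X * M 0 * Y) + y • (X * M 1 * Y) + z • (X * M 2 * Y) =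
      X * (x • M 0 + y • M 1 + z • M 2) * Y := by
    simp only [Matrix.mul_add, Matrix.add_mul, Matrix.mul_smul, Matrix.smul_mul]
  rw [this, Matrix.det_mul, Matrix.det_mul, h]
  ring

theorem IsJmatEquiv.of_mul {M : Fin 3 → Matrix (Fin 3) (Fin 3) K} {a b : K}
    {X Y : Matrix (Fin 3) (Fin 3) K} (hX : X.det ≠ 0) (hY : Y.det ≠ 0)
    (h : IsJmatEquiv (fun k => X * M k * Y) a b) : IsJmatEquiv M a b := by
  obtain ⟨X', Y', lam, mu, hX', hY', hP, h⟩ := h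
  refine ⟨X' * X, Y * Y', lam, mu, ?_, ?_, hP, fun k => ?_⟩
  · rw [Matrix.det_mul]; exact mul_ne_zero hX' hX
  · rw [Matrix.det_mul]; exact mul_ne_zero hY hY'
  · rw [← h k]; simp only [Matrix.mul_assoc]

/-- The pencil `x • !![x₁₁, x₁₂, x₁₃; x₂₁, x₂₂, x₂₃; x₃₁, x₃₂, 0] +
y • !![0, 1, 0; 1, 0, 0; 0, 0, 0] + z • !![z₁₁, z₁₂, 0; z₂₁, z₂₂, 0; 0, 0, z₃₃]`. -/
def reducedPencil (x₁₁ x₁₂ x₁₃ x₂₁ x₂₂ x₂₃ x₃₁ x₃₂ z₁₁ z₁₂ z₂₁ z₂₂ z₃₃ : K) :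
    Fin 3 → Matrix (Fin 3) (Fin 3) K :=
  ![!![x₁₁, x₁₂, x₁₃; x₂₁, x₂₂, x₂₃; x₃₁, x₃₂, 0], !![0, 1, 0; 1, 0, 0; 0, 0, 0],
    !![z₁₁, z₁₂, 0; z₂₁, z₂₂, 0; 0, 0, z₃₃]]

theorem IsWeierstrassRep.reducedPencil_coeff (h2 : (2 : K) ≠ 0)
    {x₁₁ x₁₂ x₁₃ x₂₁ x₂₂ x₂₃ x₃₁ x₃₂ z₁₁ z₁₂ z₂₁ z₂₂ z₃₃ a b c : K}
    (h : IsWeierstrassRep (reducedPencil x₁₁ x₁₂ x₁₃ x₂₁ x₂₂ x₂₃ x₃₁ x₃₂ z₁₁ z₁₂ z₂₁ z₂₂ z₃₃)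
      a b c) :
    z₃₃ = -c ∧ x₁₃ * x₃₂ + x₂₃ * x₃₁ = 0 ∧ (x₁₂ + x₂₁) * z₃₃ = 0 ∧ (z₁₂ + z₂₁) * z₃₃ = 0 ∧
    -x₁₁ * x₂₃ * x₃₂ + x₁₂ * x₂₃ * x₃₁ + x₁₃ * x₂₁ * x₃₂ - x₁₃ * x₂₂ * x₃₁ = -c ∧
    x₁₁ * x₂₂ * z₃₃ - x₁₂ * x₂₁ * z₃₃ - z₁₁ * x₂₃ * x₃₂ + z₁₂ * x₂₃ * x₃₁ + z₂₁ * x₁₃ * x₃₂ -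
      z₂₂ * x₁₃ * x₃₁ = 0 ∧
    (x₁₁ * z₂₂ + z₁₁ * x₂₂ - x₁₂ * z₂₁ - z₁₂ * x₂₁) * z₃₃ = -(c * a) ∧
    (z₁₁ * z₂₂ - z₁₂ * z₂₁) * z₃₃ = -(c * b) := by
  obtain ⟨g1, g2, g3, g4, g5, g6, g7, g8, g9, g0⟩ := ternary_cubic_coeff_eq_zero h2
    (c₁ := -x₁₁ * x₂₃ * x₃₂ + x₁₂ * x₂₃ * x₃₁ + x₁₃ * x₂₁ * x₃₂ - x₁₃ * x₂₂ * x₃₁ + c)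
    (c₂ := 0) (c₃ := (z₁₁ * z₂₂ - z₁₂ * z₂₁) * z₃₃ + c * b)
    (c₄ := x₁₃ * x₃₂ + x₂₃ * x₃₁)
    (c₅ := x₁₁ * x₂₂ * z₃₃ - x₁₂ * x₂₁ * z₃₃ - z₁₁ * x₂₃ * x₃₂ + z₁₂ * x₂₃ * x₃₁ +
      z₂₁ * x₁₃ * x₃₂ - z₂₂ * x₁₃ * x₃₁)
    (c₆ := 0) (c₇ := -z₃₃ - c)
    (c₈ := (x₁₁ * z₂₂ + z₁₁ * x₂₂ - x₁₂ * z₂₁ - z₁₂ * x₂₁) * z₃₃ + c * a)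
    (c₉ := -(z₁₂ + z₂₁) * z₃₃) (c₀ := -(x₁₂ + x₂₁) * z₃₃) fun x y z => by
      have := h x y z
      simp [reducedPencil, Matrix.det_fin_three] at this
      linear_combination this
  refine ⟨?_, ?_, ?_, ?_, ?_, ?_, ?_, ?_⟩
  · linear_combination -g7
  · linear_combination g4
  · linear_combination -g0
  · linear_combination -g9
  · linear_combination g1
  · linear_combination g5
  · linear_combination g8
  · linear_combination g3

theorem IsWeierstrassRep.isJmatEquiv_of_corner_one {a b : K} (h2 : (2 : K) ≠ 0)
    {x₁₁ x₁₂ x₂₁ x₂₂ z₁₁ z₁₂ z₂₁ z₂₂ z₃₃ : K}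
    (h : IsWeierstrassRep (reducedPencil x₁₁ x₁₂ 0 x₂₁ x₂₂ 1 0 1 z₁₁ z₁₂ z₂₁ z₂₂ z₃₃) a b 1) :
    IsJmatEquiv (reducedPencil x₁₁ x₁₂ 0 x₂₁ x₂₂ 1 0 1 z₁₁ z₁₂ z₂₁ z₂₂ z₃₃) a b := by
  obtain ⟨e1, -, e3, e4, e5, e6, e7, e8⟩ := h.reducedPencil_coeff h2
  obtain rfl := e1
  have f3 : x₂₁ = -x₁₂ := by linear_combination -e3
  have f4 : z₂₁ = -z₁₂ := by linear_combination -e4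
  have f5 : x₁₁ = 1 := by linear_combination -e5
  subst f3 f4 f5
  have f6 : z₁₁ = -x₂₂ - x₁₂ ^ 2 := by linear_combination -e6
  subst f6
  refine ⟨!![1, 0, 0; x₁₂, 1, 0; 0, 0, 1], !![1, -x₁₂, 0; 0, 1, 0; 0, 0, 1], x₂₂ + x₁₂ ^ 2,
    -(z₁₂ + x₁₂ * (x₂₂ + x₁₂ ^ 2)), ?_, ?_, ?_, fun k => ?_⟩
  · simp [Matrix.det_fin_three]
  · simp [Matrix.det_fin_three]
  · linear_combination (-(x₂₂ + x₁₂ ^ 2)) * e7 - e8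
  · fin_cases k <;> ext i j <;> fin_cases i <;> fin_cases j <;>
      simp [reducedPencil, Jmat, Matrix.mul_apply, Fin.sum_univ_three] <;>
      first | ring1 | linear_combination -e7

theorem IsWeierstrassRep.isJmatEquiv_of_reduced {a b c : K} (h2 : (2 : K) ≠ 0) (hc : c ≠ 0)
    {x₁₁ x₁₂ x₂₁ x₂₂ x₃₂ z₁₁ z₁₂ z₂₁ z₂₂ z₃₃ : K}
    (h : IsWeierstrassRep (reducedPencil x₁₁ x₁₂ 0 x₂₁ x₂₂ 1 0 x₃₂ z₁₁ z₁₂ z₂₁ z₂₂ z₃₃) a b c) :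
    IsJmatEquiv (reducedPencil x₁₁ x₁₂ 0 x₂₁ x₂₂ 1 0 x₃₂ z₁₁ z₁₂ z₂₁ z₂₂ z₃₃) a b := by
  obtain ⟨-, -, -, -, e5, -⟩ := h.reducedPencil_coeff h2
  have hx : x₃₂ ≠ 0 := by
    rintro rfl
    exact hc (by linear_combination e5)
  set X : Matrix (Fin 3) (Fin 3) K := !![x₃₂ / c, 0, 0; 0, 1, 0; 0, 0, 1 / c] with hX
  set Y : Matrix (Fin 3) (Fin 3) K := !![1, 0, 0; 0, c / x₃₂, 0; 0, 0, 1] with hY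
  have hXd : X.det = x₃₂ / c ^ 2 := by simp [hX, Matrix.det_fin_three]; field_simp
  have hYd : Y.det = c / x₃₂ := by simp [hY, Matrix.det_fin_three]
  have hXY : (fun k => X * reducedPencil x₁₁ x₁₂ 0 x₂₁ x₂₂ 1 0 x₃₂ z₁₁ z₁₂ z₂₁ z₂₂ z₃₃ k * Y) =
      reducedPencil (x₃₂ / c * x₁₁) x₁₂ 0 x₂₁ (c / x₃₂ * x₂₂) 1 0 1
        (x₃₂ / c * z₁₁) z₁₂ z₂₁ (c / x₃₂ * z₂₂) (z₃₃ / c) := by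
    ext k i j
    fin_cases k <;> fin_cases i <;> fin_cases j <;>
      simp [hX, hY, reducedPencil, Matrix.mul_apply, Fin.sum_univ_three] <;> field_simp
  have h' := h.mul X Y
  have hXYc : X.det * Y.det * c = 1 := by rw [hXd, hYd]; field_simp
  refine IsJmatEquiv.of_mul (X := X) (Y := Y) (fun h0 => ?_) (fun h0 => ?_) ?_
  · simp [h0] at hXYc
  · simp [h0] at hXYc
  · rw [hXYc, hXY] at h'
    rw [hXY]
    exact h'.isJmatEquiv_of_corner_one h2

theorem IsWeierstrassRep.isJmatEquiv_of_reducedPencil {a b c : K} (h2 : (2 : K) ≠ 0) (hc : c ≠ 0)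
    {x₁₁ x₁₂ x₁₃ x₂₁ x₂₂ x₂₃ x₃₁ x₃₂ z₁₁ z₁₂ z₂₁ z₂₂ z₃₃ : K}
    (h : IsWeierstrassRep (reducedPencil x₁₁ x₁₂ x₁₃ x₂₁ x₂₂ x₂₃ x₃₁ x₃₂ z₁₁ z₁₂ z₂₁ z₂₂ z₃₃)
      a b c) :
    IsJmatEquiv (reducedPencil x₁₁ x₁₂ x₁₃ x₂₁ x₂₂ x₂₃ x₃₁ x₃₂ z₁₁ z₁₂ z₂₁ z₂₂ z₃₃) a b := by
  obtain ⟨-, e2, -, -, e5, -⟩ := h.reducedPencil_coeff h2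
  obtain ⟨p, q, r, s, hd, h1, h2'⟩ : ∃ p q r s : K, p * s - q * r ≠ 0 ∧
      p * x₁₃ + q * x₂₃ = 0 ∧ r * x₁₃ + s * x₂₃ = 1 := by
    by_cases hb : x₂₃ = 0
    · have ha : x₁₃ ≠ 0 := by
        rintro rfl
        subst hb
        exact hc (by linear_combination e5)
      exact ⟨0, 1, 1 / x₁₃, 0, by simp [ha], by simp [hb], by simp [hb, ha]⟩
    · exact ⟨1, -x₁₃ / x₂₃, 0, 1 / x₂₃, by simp [hb], by field_simp; ring, by field_simp; ring⟩
  set M := reducedPencil x₁₁ x₁₂ x₁₃ x₂₁ x₂₂ x₂₃ x₃₁ x₃₂ z₁₁ z₁₂ z₂₁ z₂₂ z₃₃ with hM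
  set d := p * s - q * r with hdd
  set X : Matrix (Fin 3) (Fin 3) K := !![p, q, 0; r, s, 0; 0, 0, 1] with hX
  set Y : Matrix (Fin 3) (Fin 3) K := !![p / d, -r / d, 0; -q / d, s / d, 0; 0, 0, 1] with hY
  have hXd : X.det = d := by simp [hX, Matrix.det_fin_three, hdd]
  have hYd : Y.det = 1 / d := by
    simp [hY, Matrix.det_fin_three]
    field_simp
    linear_combination -hdd
  obtain ⟨y₁₁, y₁₂, y₂₁, y₂₂, y₃₁, y₃₂, w₁₁, w₁₂, w₂₁, w₂₂, hXY⟩ :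
      ∃ y₁₁ y₁₂ y₂₁ y₂₂ y₃₁ y₃₂ w₁₁ w₁₂ w₂₁ w₂₂ : K, (fun k => X * M k * Y) =
      reducedPencil y₁₁ y₁₂ 0 y₂₁ y₂₂ 1 y₃₁ y₃₂ w₁₁ w₁₂ w₂₁ w₂₂ z₃₃ := by
    refine ⟨(X * M 0 * Y) 0 0, (X * M 0 * Y) 0 1, (X * M 0 * Y) 1 0, (X * M 0 * Y) 1 1,
      (X * M 0 * Y) 2 0, (X * M 0 * Y) 2 1, (X * M 2 * Y) 0 0, (X * M 2 * Y) 0 1,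
      (X * M 2 * Y) 1 0, (X * M 2 * Y) 1 1, ?_⟩
    have h1' : X * M 1 * Y = M 1 := by
      ext i j
      fin_cases i <;> fin_cases j <;>
        simp [hX, hY, hM, reducedPencil, Matrix.mul_apply, Fin.sum_univ_three] <;>
        field_simp <;> linear_combination -hdd
    ext k i j
    fin_cases k
    · fin_cases i <;> fin_cases j <;> first | rfl |
        simp [hX, hY, hM, reducedPencil, Matrix.mul_apply, Fin.sum_univ_three, h1, h2']
    · exact congrFun (congrFun h1' i) j
    · fin_cases i <;> fin_cases j <;> first | rfl |
        simp [hX, hY, hM, reducedPencil, Matrix.mul_apply, Fin.sum_univ_three]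
  have h' := h.mul X Y
  have hXYc : X.det * Y.det * c = c := by rw [hXd, hYd]; field_simp
  refine IsJmatEquiv.of_mul (X := X) (Y := Y) (by rwa [hXd]) (by rw [hYd]; simp [hd]) ?_
  rw [hXYc, hXY] at h'
  rw [hXY]
  obtain ⟨-, e2', -⟩ := h'.reducedPencil_coeff h2
  obtain rfl : y₃₁ = 0 := by linear_combination e2'
  exact h'.isJmatEquiv_of_reduced h2 hc

theorem IsWeierstrassRep.isJmatEquiv_of_middle {M : Fin 3 → Matrix (Fin 3) (Fin 3) K} {a b c : K}
    (h2 : (2 : K) ≠ 0) (hc : c ≠ 0) (h : IsWeierstrassRep M a b c)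
    (hM : M 1 = !![0, 1, 0; 1, 0, 0; 0, 0, 0]) : IsJmatEquiv M a b := by
  obtain ⟨h0, h2'⟩ : M 0 2 2 = 0 ∧ M 2 2 2 = -c := by
    have e1 := h 0 1 1
    have e2 := h 0 (-1) 1
    have e3 := h 0 0 1
    have e4 := h 1 1 0
    have e5 := h 1 (-1) 0
    have e6 := h 1 0 0
    simp [hM, Matrix.det_fin_three] at e1 e2 e3 e4 e5 e6
    constructor
    · exact (mul_eq_zero_iff_left h2).1 (by linear_combination 2 * e6 - e4 - e5)
    · exact mul_left_cancel₀ h2 (by linear_combination 2 * e3 - e1 - e2)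
  set X : Matrix (Fin 3) (Fin 3) K := !![1, 0, M 2 0 2 / c; 0, 1, M 2 1 2 / c; 0, 0, 1] with hX
  set Y : Matrix (Fin 3) (Fin 3) K := !![1, 0, 0; 0, 1, 0; M 2 2 0 / c, M 2 2 1 / c, 1] with hY
  have hXd : X.det = 1 := by simp [hX, Matrix.det_fin_three]
  have hYd : Y.det = 1 := by simp [hY, Matrix.det_fin_three]
  have hXY : (fun k => X * M k * Y) = reducedPencil ((X * M 0 * Y) 0 0) ((X * M 0 * Y) 0 1)
      ((X * M 0 * Y) 0 2) ((X * M 0 * Y) 1 0) ((X * M 0 * Y) 1 1) ((X * M 0 * Y) 1 2)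
      ((X * M 0 * Y) 2 0) ((X * M 0 * Y) 2 1) ((X * M 2 * Y) 0 0) ((X * M 2 * Y) 0 1)
      ((X * M 2 * Y) 1 0) ((X * M 2 * Y) 1 1) ((X * M 2 * Y) 2 2) := by
    ext k i j
    fin_cases k
    · fin_cases i <;> fin_cases j <;> first | rfl |
        simp [hX, hY, h0, reducedPencil, Matrix.mul_apply, Fin.sum_univ_three, Matrix.vecMul,
          dotProduct]
    · fin_cases i <;> fin_cases j <;>
        simp [hX, hY, hM, reducedPencil, Matrix.mul_apply, Fin.sum_univ_three]
    · fin_cases i <;> fin_cases j <;> first | rfl |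
        (simp [hX, hY, h2', reducedPencil, Matrix.mul_apply, Fin.sum_univ_three, Matrix.vecMul,
          dotProduct]; field_simp; ring)
  have h' := h.mul X Y
  refine IsJmatEquiv.of_mul (X := X) (Y := Y) (by simp [hXd]) (by simp [hYd]) ?_
  rw [hXd, hYd, one_mul, one_mul, hXY] at h'
  rw [hXY]
  exact h'.isJmatEquiv_of_reducedPencil h2 hc

theorem IsWeierstrassRep.isJmatEquiv_of_diagonal {M : Fin 3 → Matrix (Fin 3) (Fin 3) K} {a b c : K}
    (h2 : (2 : K) ≠ 0) (hc : c ≠ 0) (h : IsWeierstrassRep M a b c) {D : Fin 3 → K}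
    (hM : M 1 = Matrix.diagonal D) : IsJmatEquiv M a b := by
  replace hM : M 1 = !![D 0, 0, 0; 0, D 1, 0; 0, 0, D 2] := by
    ext i j
    fin_cases i <;> fin_cases j <;> simp [hM]
  have key (X Y : Matrix (Fin 3) (Fin 3) K) (hX : X.det ≠ 0) (hY : Y.det ≠ 0)
      (hXY : X * M 1 * Y = !![0, 1, 0; 1, 0, 0; 0, 0, 0]) : IsJmatEquiv M a b :=
    IsJmatEquiv.of_mul hX hY <|
      (h.mul X Y).isJmatEquiv_of_middle h2 (mul_ne_zero (mul_ne_zero hX hY) hc) hXY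
  have e1 := h 0 1 0
  have e2 := h 0 1 1
  have e3 := h 0 (-1) 1
  have e4 := h 0 0 1
  simp [hM, Matrix.det_fin_three] at e1 e2 e3 e4
  have e5 : 2 * (D 0 * D 1 * M 2 2 2 + D 0 * D 2 * M 2 1 1 + D 1 * D 2 * M 2 0 0) ≠ 2 * 0 := by
    intro h0
    exact hc (mul_left_cancel₀ h2 (by linear_combination h0 + 2 * e4 - e2 - e3))
  replace e5 : D 0 * D 1 * M 2 2 2 + D 0 * D 2 * M 2 1 1 + D 1 * D 2 * M 2 0 0 ≠ 0 :=
    fun h0 => e5 (congrArg (2 * ·) h0)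
  by_cases d0 : D 0 = 0
  · simp only [d0, zero_mul, zero_add, ne_eq, mul_eq_zero, not_or] at e5
    obtain ⟨⟨d1, d2⟩, -⟩ := e5
    refine key !![0, 0, 1 / D 2; 0, 1 / D 1, 0; 1, 0, 0] !![0, 0, 1; 1, 0, 0; 0, 1, 0] ?_ ?_ ?_
    · simp [Matrix.det_fin_three, d1, d2]
    · simp [Matrix.det_fin_three]
    · ext i j
      fin_cases i <;> fin_cases j <;>
        simp [hM, Matrix.mul_apply, Fin.sum_univ_three, d0, d1, d2]
  by_cases d1 : D 1 = 0
  · simp only [d1, zero_mul, mul_zero, zero_add, add_zero, ne_eq, mul_eq_zero, not_or] at e5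
    obtain ⟨⟨-, d2⟩, -⟩ := e5
    refine key !![0, 0, 1 / D 2; 1 / D 0, 0, 0; 0, 1, 0] !![1, 0, 0; 0, 0, 1; 0, 1, 0] ?_ ?_ ?_
    · simp [Matrix.det_fin_three, d0, d2]
    · simp [Matrix.det_fin_three]
    · ext i j
      fin_cases i <;> fin_cases j <;>
        simp [hM, Matrix.mul_apply, Fin.sum_univ_three, d0, d1, d2]
  have d2 : D 2 = 0 := by simpa [d0, d1] using e1
  refine key !![0, 1 / D 1, 0; 1 / D 0, 0, 0; 0, 0, 1] !![1, 0, 0; 0, 1, 0; 0, 0, 1] ?_ ?_ ?_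
  · simp [Matrix.det_fin_three, d0, d1]
  · simp [Matrix.det_fin_three]
  · ext i j
    fin_cases i <;> fin_cases j <;>
      simp [hM, Matrix.mul_apply, Fin.sum_univ_three, d0, d1, d2]

theorem IsWeierstrassRep.isJmatEquiv {M : Fin 3 → Matrix (Fin 3) (Fin 3) K} {a b c : K}
    (h2 : (2 : K) ≠ 0) (hc : c ≠ 0) (h : IsWeierstrassRep M a b c) : IsJmatEquiv M a b := by
  obtain ⟨L, L', D, hD⟩ :=
    Matrix.Pivot.exists_list_transvec_mul_mul_list_transvec_eq_diagonal (M 1)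
  have hL := Matrix.TransvectionStruct.det_toMatrix_prod L
  have hL' := Matrix.TransvectionStruct.det_toMatrix_prod L'
  refine IsJmatEquiv.of_mul (X := (L.map Matrix.TransvectionStruct.toMatrix).prod)
    (Y := (L'.map Matrix.TransvectionStruct.toMatrix).prod) (by simp [hL]) (by simp [hL'])
    ((h.mul _ _).isJmatEquiv_of_diagonal h2 ?_ hD)
  simpa [hL, hL'] using hc

end DeterminantalRepresentation

/-! ### Weierstrass form of a smooth plane cubic with a rational flex -/

section WeierstrassForm

open MvPolynomial

variable {K : Type*} [Field K]

/-- The polynomial obtained from `f` by the linear substitution `v ↦ Z v`. -/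
noncomputable def linearSubst (Z : Matrix (Fin 3) (Fin 3) K) (f : MvPolynomial (Fin 3) K) :
    MvPolynomial (Fin 3) K :=
  bind₁ (fun i : Fin 3 => ∑ j : Fin 3, C (Z i j) * X j) f

theorem linearSubst_mul (Y Z : Matrix (Fin 3) (Fin 3) K) (f : MvPolynomial (Fin 3) K) :
    linearSubst (Y * Z) f = linearSubst Z (linearSubst Y f) := by
  simp only [linearSubst, bind₁_bind₁]
  congr 2
  ext1 i
  simp only [map_sum, map_mul, algHom_C, algebraMap_eq, bind₁_X_right, Matrix.mul_apply,
    Finset.sum_mul, Finset.mul_sum]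
  rw [Finset.sum_comm]
  simp only [mul_assoc]

theorem aeval_linearSubst {L : Type*} [Field L] [Algebra K L] (Z : Matrix (Fin 3) (Fin 3) K)
    (f : MvPolynomial (Fin 3) K) (v : Fin 3 → L) :
    aeval v (linearSubst Z f) = aeval (Z.map (algebraMap K L) *ᵥ v) f := by
  rw [linearSubst, aeval_bind₁]
  congr 2
  ext i
  simp [Matrix.mulVec, dotProduct]

theorem eval_linearSubst (Z : Matrix (Fin 3) (Fin 3) K) (f : MvPolynomial (Fin 3) K)
    (v : Fin 3 → K) : eval v (linearSubst Z f) = eval (Z *ᵥ v) f := by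
  have h := aeval_linearSubst Z f v
  simp only [aeval_eq_eval, Algebra.algebraMap_self, RingHom.coe_id, Matrix.map_id] at h
  exact h

theorem pderiv_linearSubst (Z : Matrix (Fin 3) (Fin 3) K) (f : MvPolynomial (Fin 3) K)
    (k : Fin 3) :
    pderiv k (linearSubst Z f) = ∑ i, C (Z i k) * linearSubst Z (pderiv i f) := by
  induction f using MvPolynomial.induction_on with
  | C a => simp [linearSubst]
  | add p q hp hq =>
    simp only [linearSubst, map_add, mul_add, Finset.sum_add_distrib] at hp hq ⊢
    rw [hp, hq]
  | mul_X p i hp =>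
    simp only [linearSubst, map_mul, bind₁_X_right, Derivation.leibniz, smul_eq_mul, map_add,
      mul_add, Finset.sum_add_distrib] at hp ⊢
    rw [hp]
    simp [pderiv_X, Pi.single_apply, Finset.mul_sum]
    rw [mul_comm]
    exact congrArg₂ _ rfl (Finset.sum_congr rfl fun _ _ => by ring)

theorem isHomogeneous_linearSubst (Z : Matrix (Fin 3) (Fin 3) K) {f : MvPolynomial (Fin 3) K}
    {n : ℕ} (hf : f.IsHomogeneous n) : (linearSubst Z f).IsHomogeneous n := by
  have := hf.aeval (S := K) (fun i : Fin 3 => ∑ j : Fin 3, C (Z i j) * X j) (n := 1) fun i =>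
    IsHomogeneous.sum _ _ _ fun j _ => by
      simpa using (isHomogeneous_C _ (Z i j)).mul (isHomogeneous_X K j)
  simpa [linearSubst] using this

theorem smoothCubic_linearSubst {f : MvPolynomial (Fin 3) K} (hf : SmoothCubic f)
    {Z : Matrix (Fin 3) (Fin 3) K} (hZ : Z.det ≠ 0) : SmoothCubic (linearSubst Z f) := by
  refine ⟨isHomogeneous_linearSubst Z hf.1, fun v hv ⟨h0, h1⟩ => ?_⟩
  set Z' := Z.map (algebraMap K (AlgebraicClosure K)) with hZ'
  have hd : Z'.det ≠ 0 := by
    rw [hZ', ← RingHom.mapMatrix_apply, ← RingHom.map_det]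
    simpa using hZ
  refine hf.2 (Z' *ᵥ v) (fun h => hv (Matrix.eq_zero_of_mulVec_eq_zero hd h)) ⟨?_, ?_⟩
  · rwa [aeval_linearSubst] at h0
  · have : (fun i => aeval (Z' *ᵥ v) (pderiv i f)) ᵥ* Z' = 0 := by
      ext k
      have := h1 k
      simp only [pderiv_linearSubst, map_sum, map_mul, aeval_linearSubst, algHom_C] at this
      simpa [Matrix.vecMul, dotProduct, mul_comm, hZ'] using this
    exact congrFun (Matrix.eq_zero_of_vecMul_eq_zero hd this)

theorem SmoothCubic.C_mul {f : MvPolynomial (Fin 3) K} (hf : SmoothCubic f) {c : K} (hc : c ≠ 0) :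
    SmoothCubic (C c * f) := by
  refine ⟨by simpa using (isHomogeneous_C _ c).mul hf.1, fun v hv ⟨h0, h1⟩ => hf.2 v hv ⟨?_, ?_⟩⟩
  · simpa [hc] using h0
  · simpa [hc] using h1

theorem SmoothCubic.eval_ne {f : MvPolynomial (Fin 3) K} (hf : SmoothCubic f) {v : Fin 3 → K}
    (hv : v ≠ 0) : ¬(eval v f = 0 ∧ ∀ k, eval v (pderiv k f) = 0) := fun ⟨h0, h1⟩ => by
  have key (p : MvPolynomial (Fin 3) K) (hp : eval v p = 0) :
      aeval (fun i => algebraMap K (AlgebraicClosure K) (v i)) p = 0 := by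
    have := aeval_algebraMap_apply (AlgebraicClosure K) v p
    rw [aeval_eq_eval, hp, map_zero] at this
    exact this
  refine hf.2 (fun i => algebraMap K _ (v i)) (fun h => hv ?_) ⟨key _ h0, fun k => key _ (h1 k)⟩
  ext i
  simpa using congrFun h i

theorem SmoothCubic.ne_zero {f : MvPolynomial (Fin 3) K} (hf : SmoothCubic f) : f ≠ 0 := by
  rintro rfl
  exact hf.eval_ne (v := 1) one_ne_zero (by simp)

/-- `v` lies on the zero locus of `f` and on that of its Hessian determinant. -/
def IsFlex (f : MvPolynomial (Fin 3) K) (v : Fin 3 → K) : Prop :=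
  eval v f = 0 ∧ (Matrix.of fun i j => eval v (pderiv i (pderiv j f))).det = 0

theorem isFlex_linearSubst {f : MvPolynomial (Fin 3) K} {Z : Matrix (Fin 3) (Fin 3) K}
    {v : Fin 3 → K} (h : IsFlex f (Z *ᵥ v)) : IsFlex (linearSubst Z f) v := by
  refine ⟨by rw [eval_linearSubst, h.1], ?_⟩
  have : (Matrix.of fun i j => eval v (pderiv i (pderiv j (linearSubst Z f)))) =
      Zᵀ * (Matrix.of fun i j => eval (Z *ᵥ v) (pderiv i (pderiv j f))) * Z := by
    ext i j
    simp only [pderiv_linearSubst, map_sum, map_mul, Derivation.leibniz, Matrix.of_apply,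
      Matrix.mul_apply, Matrix.transpose_apply, eval_linearSubst, eval_C, pderiv_C,
      smul_eq_mul, mul_zero, add_zero, Finset.mul_sum, Finset.sum_mul]
    refine Finset.sum_congr rfl fun a _ => Finset.sum_congr rfl fun b _ => ?_
    ring
  rw [this, Matrix.det_mul, Matrix.det_mul, h.2]
  simp

/-- The ternary cubic form with the given coefficients. -/
noncomputable def ternaryCubic (c₁ c₂ c₃ c₄ c₅ c₆ c₇ c₈ c₉ c₀ : K) : MvPolynomial (Fin 3) K :=
  C c₁ * X 0 ^ 3 + C c₂ * X 1 ^ 3 + C c₃ * X 2 ^ 3 + C c₄ * (X 0 ^ 2 * X 1) +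
    C c₅ * (X 0 ^ 2 * X 2) + C c₆ * (X 0 * X 1 ^ 2) + C c₇ * (X 1 ^ 2 * X 2) +
    C c₈ * (X 0 * X 2 ^ 2) + C c₉ * (X 1 * X 2 ^ 2) + C c₀ * (X 0 * X 1 * X 2)

theorem exists_eq_ternaryCubic {f : MvPolynomial (Fin 3) K} (hf : f.IsHomogeneous 3) :
    ∃ c₁ c₂ c₃ c₄ c₅ c₆ c₇ c₈ c₉ c₀ : K, f = ternaryCubic c₁ c₂ c₃ c₄ c₅ c₆ c₇ c₈ c₉ c₀ := by
  let s (i j k : ℕ) : Fin 3 →₀ ℕ := Finsupp.single 0 i + Finsupp.single 1 j + Finsupp.single 2 k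
  have hs (i j k : ℕ) (c : K) : monomial (s i j k) c = C c * (X 0 ^ i * X 1 ^ j * X 2 ^ k) := by
    simp [s, monomial_eq, Finsupp.prod_fintype, Fin.prod_univ_three]
  have hinj (i j k i' j' k' : ℕ) : s i j k = s i' j' k' ↔ i = i' ∧ j = j' ∧ k = k' := by
    simp [s, Finsupp.ext_iff, Fin.forall_fin_succ]
  have hm (m : Fin 3 →₀ ℕ) : m = s (m 0) (m 1) (m 2) := by
    ext i
    fin_cases i <;> simp [s]
  refine ⟨f.coeff (s 3 0 0), f.coeff (s 0 3 0), f.coeff (s 0 0 3), f.coeff (s 2 1 0),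
    f.coeff (s 2 0 1), f.coeff (s 1 2 0), f.coeff (s 0 2 1), f.coeff (s 1 0 2), f.coeff (s 0 1 2),
    f.coeff (s 1 1 1), ?_⟩
  have ht (c₁ c₂ c₃ c₄ c₅ c₆ c₇ c₈ c₉ c₀ : K) : ternaryCubic c₁ c₂ c₃ c₄ c₅ c₆ c₇ c₈ c₉ c₀ =
      monomial (s 3 0 0) c₁ + monomial (s 0 3 0) c₂ + monomial (s 0 0 3) c₃ +
      monomial (s 2 1 0) c₄ + monomial (s 2 0 1) c₅ + monomial (s 1 2 0) c₆ +
      monomial (s 0 2 1) c₇ + monomial (s 1 0 2) c₈ + monomial (s 0 1 2) c₉ +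
      monomial (s 1 1 1) c₀ := by
    simp [hs, ternaryCubic]
  rw [ht]
  ext m
  rw [hm m]
  generalize m 0 = i, m 1 = j, m 2 = k
  simp only [coeff_add, coeff_monomial, hinj]
  by_cases h : i + j + k = 3
  · have hi : i ≤ 3 := by omega
    have hj : j ≤ 3 := by omega
    obtain rfl : k = 3 - i - j := by omega
    interval_cases i <;> interval_cases j <;> simp at h ⊢
  · rw [hf.coeff_eq_zero (by simpa [s, Finsupp.degree_eq_sum, Fin.sum_univ_three] using h)]
    repeat rw [if_neg (by omega)]
    simp

theorem isHomogeneous_ternaryCubic (c₁ c₂ c₃ c₄ c₅ c₆ c₇ c₈ c₉ c₀ : K) :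
    (ternaryCubic c₁ c₂ c₃ c₄ c₅ c₆ c₇ c₈ c₉ c₀).IsHomogeneous 3 := by
  have h (i j k : ℕ) (hd : i + j + k = 3) (c : K) :
      (C c * (X 0 ^ i * X 1 ^ j * X 2 ^ k) : MvPolynomial (Fin 3) K).IsHomogeneous 3 := by
    simpa [hd] using (isHomogeneous_C _ c).mul
      (((isHomogeneous_X_pow 0 i).mul (isHomogeneous_X_pow 1 j)).mul (isHomogeneous_X_pow 2 k))
  have := (((((((((h 3 0 0 rfl c₁).add (h 0 3 0 rfl c₂)).add (h 0 0 3 rfl c₃)).add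
    (h 2 1 0 rfl c₄)).add (h 2 0 1 rfl c₅)).add (h 1 2 0 rfl c₆)).add (h 0 2 1 rfl c₇)).add
    (h 1 0 2 rfl c₈)).add (h 0 1 2 rfl c₉)).add (h 1 1 1 rfl c₀)
  simpa [ternaryCubic] using this

theorem eval_ternaryCubic (c₁ c₂ c₃ c₄ c₅ c₆ c₇ c₈ c₉ c₀ : K) (v : Fin 3 → K) :
    eval v (ternaryCubic c₁ c₂ c₃ c₄ c₅ c₆ c₇ c₈ c₉ c₀) =
      c₁ * v 0 ^ 3 + c₂ * v 1 ^ 3 + c₃ * v 2 ^ 3 + c₄ * (v 0 ^ 2 * v 1) + c₅ * (v 0 ^ 2 * v 2) +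
      c₆ * (v 0 * v 1 ^ 2) + c₇ * (v 1 ^ 2 * v 2) + c₈ * (v 0 * v 2 ^ 2) + c₉ * (v 1 * v 2 ^ 2) +
      c₀ * (v 0 * v 1 * v 2) := by
  simp [ternaryCubic]

/-- A cubic form in three variables is determined by its values at the rational points. -/
theorem eq_of_eval_eq_of_isHomogeneous_three (h2 : (2 : K) ≠ 0) {f g : MvPolynomial (Fin 3) K}
    (hf : f.IsHomogeneous 3) (hg : g.IsHomogeneous 3) (h : ∀ v, eval v f = eval v g) : f = g := by
  rw [← sub_eq_zero]
  obtain ⟨c₁, c₂, c₃, c₄, c₅, c₆, c₇, c₈, c₉, c₀, hc⟩ := exists_eq_ternaryCubic (hf.sub hg)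
  have hz : ∀ v, eval v (f - g) = 0 := fun v => by rw [map_sub, h, sub_self]
  rw [hc] at hz ⊢
  obtain ⟨rfl, rfl, rfl, rfl, rfl, rfl, rfl, rfl, rfl, rfl⟩ :=
    ternary_cubic_coeff_eq_zero h2 fun x y z => by
      have := hz ![x, y, z]
      rw [eval_ternaryCubic] at this
      simpa using this
  simp [ternaryCubic]

/-- The Weierstrass cubic `y²z - x³ - axz² - bz³`. -/
noncomputable def weierstrassCubic (a b : K) : MvPolynomial (Fin 3) K :=
  X 1 ^ 2 * X 2 - X 0 ^ 3 - C a * X 0 * X 2 ^ 2 - C b * X 2 ^ 3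

theorem weierstrassCubic_eq_ternaryCubic (a b : K) :
    weierstrassCubic a b = ternaryCubic (-1) 0 (-b) 0 0 0 1 (-a) 0 0 := by
  simp [weierstrassCubic, ternaryCubic]
  ring

theorem SmoothCubic.weierstrass_discriminant_ne_zero {a b : K} (h2 : (2 : K) ≠ 0)
    (h3 : (3 : K) ≠ 0) (h : SmoothCubic (weierstrassCubic a b)) : 4 * a ^ 3 + 27 * b ^ 2 ≠ 0 := by
  intro hd
  by_cases ha : a = 0
  · have hb : b = 0 := by
      have : (3 : K) ^ 3 * b ^ 2 = 0 := by linear_combination hd - 4 * a ^ 2 * ha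
      simpa [h3] using this
    refine h.eval_ne (v := ![0, 0, 1]) (fun h0 => by simpa using congrFun h0 2) ⟨?_, fun k => ?_⟩
    · simp [weierstrassCubic, hb]
    · fin_cases k <;> simp [weierstrassCubic, pderiv_X, ha, hb]
  · refine h.eval_ne (v := ![-3 * b / (2 * a), 0, 1]) (fun h0 => by simpa using congrFun h0 2)
      ⟨?_, fun k => ?_⟩
    · simp [weierstrassCubic]
      field_simp
      linear_combination b * hd
    · fin_cases k <;> simp [weierstrassCubic, pderiv_X] <;> field_simp
      · linear_combination -hd
      · ring

theorem exists_linearSubst_eq_weierstrassCubic_of_normalized (h2 : (2 : K) ≠ 0) (h3 : (3 : K) ≠ 0)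
    {c₁ c₃ c₅ c₈ c₉ c₀ : K} (hc : c₁ ≠ 0) :
    ∃ Z : Matrix (Fin 3) (Fin 3) K, Z.det ≠ 0 ∧ ∃ d a b : K, d ≠ 0 ∧
      C d * linearSubst Z (ternaryCubic c₁ 0 c₃ 0 c₅ 0 1 c₈ c₉ c₀) = weierstrassCubic a b := by
  set A := c₅ - c₀ ^ 2 / 4
  set B := c₈ - c₀ * c₉ / 2
  set D := c₃ - c₉ ^ 2 / 4
  set s := A / 3
  refine ⟨!![1, 0, s; -c₀ / 2, 1, -(c₀ * s - c₁ * c₉) / 2; 0, 0, -c₁], ?_, -1 / c₁,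
    3 * s ^ 2 - 2 * A * s + c₁ * B, s ^ 3 - A * s ^ 2 + c₁ * B * s - c₁ ^ 2 * D, ?_, ?_⟩
  · simp [Matrix.det_fin_three, hc]
  · simp [hc]
  have h4 : (4 : K) ≠ 0 := by
    have : (4 : K) = 2 * 2 := by norm_num
    rw [this]
    exact mul_ne_zero h2 h2
  rw [weierstrassCubic_eq_ternaryCubic]
  refine eq_of_eval_eq_of_isHomogeneous_three h2 ?_ (isHomogeneous_ternaryCubic ..) fun v => ?_
  · simpa using (isHomogeneous_C _ _).mul
      (isHomogeneous_linearSubst _ (isHomogeneous_ternaryCubic ..))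
  · rw [map_mul, eval_C, eval_linearSubst, eval_ternaryCubic, eval_ternaryCubic]
    simp [Matrix.mulVec, dotProduct, Fin.sum_univ_three, s, A, B, D]
    field_simp
    ring

theorem SmoothCubic.exists_weierstrass_of_flex_tangent (h2 : (2 : K) ≠ 0) (h3 : (3 : K) ≠ 0)
    {c₁ c₃ c₄ c₅ c₈ c₉ c₀ : K} (h : SmoothCubic (ternaryCubic c₁ 0 c₃ c₄ c₅ 0 1 c₈ c₉ c₀))
    (hf : IsFlex (ternaryCubic c₁ 0 c₃ c₄ c₅ 0 1 c₈ c₉ c₀) ![0, 1, 0]) :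
    ∃ Z : Matrix (Fin 3) (Fin 3) K, Z.det ≠ 0 ∧ ∃ d a b : K, d ≠ 0 ∧
      C d * linearSubst Z (ternaryCubic c₁ 0 c₃ c₄ c₅ 0 1 c₈ c₉ c₀) = weierstrassCubic a b := by
  obtain rfl : c₄ = 0 := by
    have := hf.2
    simp [ternaryCubic, Matrix.det_fin_three, pderiv_X] at this
    exact this.resolve_right h2
  refine exists_linearSubst_eq_weierstrassCubic_of_normalized h2 h3 ?_
  rintro rfl
  obtain ⟨t, ht⟩ : ∃ t : AlgebraicClosure K,
      t ^ 2 + algebraMap K _ c₀ * t + algebraMap K _ c₅ = 0 := by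
    have h2' : NeZero (2 : AlgebraicClosure K) := ⟨by
      simpa only [map_ofNat] using (map_ne_zero (algebraMap K (AlgebraicClosure K))).2 h2⟩
    obtain ⟨s, hs⟩ := IsAlgClosed.exists_eq_mul_self
      (discrim 1 (algebraMap K (AlgebraicClosure K) c₀) (algebraMap K _ c₅))
    obtain ⟨t, ht⟩ := exists_quadratic_eq_zero one_ne_zero ⟨s, hs⟩
    exact ⟨t, by linear_combination ht⟩
  refine h.2 ![1, t, 0] (fun h0 => by simpa using congrFun h0 0) ⟨?_, fun k => ?_⟩
  · simp [ternaryCubic]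
  · fin_cases k <;> simp [ternaryCubic, pderiv_X]
    linear_combination ht

theorem SmoothCubic.exists_weierstrass_of_flex (h2 : (2 : K) ≠ 0) (h3 : (3 : K) ≠ 0)
    {f : MvPolynomial (Fin 3) K} (h : SmoothCubic f) (hf : IsFlex f ![0, 1, 0]) :
    ∃ Z : Matrix (Fin 3) (Fin 3) K, Z.det ≠ 0 ∧ ∃ d a b : K, d ≠ 0 ∧
      C d * linearSubst Z f = weierstrassCubic a b := by
  obtain ⟨c₁, c₂, c₃, c₄, c₅, c₆, c₇, c₈, c₉, c₀, rfl⟩ := exists_eq_ternaryCubic h.1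
  obtain rfl : c₂ = 0 := by simpa [eval_ternaryCubic] using hf.1
  have h67 : c₆ ≠ 0 ∨ c₇ ≠ 0 := by
    by_contra! h67
    refine h.eval_ne (v := ![0, 1, 0]) (fun h0 => by simpa using congrFun h0 1)
      ⟨hf.1, fun k => ?_⟩
    fin_cases k <;> simp [ternaryCubic, pderiv_X, h67.1, h67.2]
  obtain ⟨Z, hZ, hZv, hZ6, hZ7⟩ : ∃ Z : Matrix (Fin 3) (Fin 3) K, Z.det ≠ 0 ∧
      Z *ᵥ ![0, 1, 0] = ![0, 1, 0] ∧ c₆ * Z 0 0 + c₇ * Z 2 0 = 0 ∧ c₆ * Z 0 2 + c₇ * Z 2 2 = 1 := by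
    by_cases h7 : c₇ = 0
    · have h6 : c₆ ≠ 0 := h67.resolve_right (by simpa using h7)
      refine ⟨!![0, 0, 1 / c₆; 0, 1, 0; 1, 0, 0], ?_, ?_, ?_, ?_⟩
      · simp [Matrix.det_fin_three, h6]
      · ext i; fin_cases i <;> simp
      · simp [h7]
      · simp [h6]
    · refine ⟨!![1, 0, 0; 0, 1, 0; -c₆ / c₇, 0, 1 / c₇], ?_, ?_, ?_, ?_⟩
      · simp [Matrix.det_fin_three, h7]
      · ext i; fin_cases i <;> simp
      · simp; field_simp; ring
      · simp [h7]
  have hs := smoothCubic_linearSubst h hZ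
  have hfl := isFlex_linearSubst (Z := Z) (v := ![0, 1, 0]) (by rwa [hZv])
  obtain ⟨e₁, e₂, e₃, e₄, e₅, e₆, e₇, e₈, e₉, e₀, he⟩ := exists_eq_ternaryCubic hs.1
  obtain ⟨e2, e6, e7⟩ : e₂ = 0 ∧ e₆ = 0 ∧ e₇ = 1 := by
    have key (x y z : K) := congrArg (eval ![x, y, z]) he
    simp only [eval_linearSubst, eval_ternaryCubic] at key
    have z0 := congrFun hZv 0
    have z1 := congrFun hZv 1
    have z2 := congrFun hZv 2
    simp [Matrix.mulVec, dotProduct, Fin.sum_univ_three] at key z0 z1 z2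
    simp only [z0, z1, z2] at key
    have k1 := key 0 1 0
    have k2 := key 1 1 0
    have k3 := key 1 (-1) 0
    have k4 := key 1 0 0
    have k5 := key 0 1 1
    have k6 := key 0 (-1) 1
    have k7 := key 0 0 1
    refine ⟨by linear_combination -k1, mul_left_cancel₀ h2 ?_, mul_left_cancel₀ h2 ?_⟩
    · linear_combination 2 * hZ6 - k2 - k3 + 2 * k4
    · linear_combination 2 * hZ7 - k5 - k6 + 2 * k7
  subst e2 e6 e7
  rw [he] at hs hfl
  obtain ⟨Y, hY, d, a, b, hd, hW⟩ := hs.exists_weierstrass_of_flex_tangent h2 h3 hfl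
  refine ⟨Z * Y, ?_, d, a, b, hd, ?_⟩
  · rw [Matrix.det_mul]; exact mul_ne_zero hZ hY
  · rw [linearSubst_mul, he, hW]

theorem SmoothCubic.exists_weierstrass (h2 : (2 : K) ≠ 0) (h3 : (3 : K) ≠ 0)
    {f : MvPolynomial (Fin 3) K} (h : SmoothCubic f) (hf : HasRationalFlex f) :
    ∃ Z : Matrix (Fin 3) (Fin 3) K, Z.det ≠ 0 ∧ ∃ d a b : K, d ≠ 0 ∧
      4 * a ^ 3 + 27 * b ^ 2 ≠ 0 ∧ C d * linearSubst Z f = weierstrassCubic a b := by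
  obtain ⟨v, hv, h0, hH⟩ := hf
  obtain ⟨Z, hZ, hZv⟩ : ∃ Z : Matrix (Fin 3) (Fin 3) K, Z.det ≠ 0 ∧ Z *ᵥ ![0, 1, 0] = v := by
    have key (w u : Fin 3 → K) (hd : (Matrix.of ![w, v, u])ᵀ.det ≠ 0) :
        ∃ Z : Matrix (Fin 3) (Fin 3) K, Z.det ≠ 0 ∧ Z *ᵥ ![0, 1, 0] = v := by
      refine ⟨_, hd, ?_⟩
      ext i
      simp [Matrix.mulVec, dotProduct, Fin.sum_univ_three]
    obtain ⟨i, hi⟩ := Function.ne_iff.1 hv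
    fin_cases i
    · exact key ![0, 1, 0] ![0, 0, 1] (by simpa [Matrix.det_fin_three] using hi)
    · exact key ![1, 0, 0] ![0, 0, 1] (by simpa [Matrix.det_fin_three] using hi)
    · exact key ![1, 0, 0] ![0, 1, 0] (by simpa [Matrix.det_fin_three] using hi)
  have hfl : IsFlex f (Z *ᵥ ![0, 1, 0]) := by
    rw [hZv]
    refine ⟨h0, ?_⟩
    rw [RingHom.map_det] at hH
    rw [← hH]
    rfl
  obtain ⟨Y, hY, d, a, b, hd, hW⟩ :=
    (smoothCubic_linearSubst h hZ).exists_weierstrass_of_flex h2 h3 (isFlex_linearSubst hfl)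
  refine ⟨Z * Y, ?_, d, a, b, hd, ?_, ?_⟩
  · rw [Matrix.det_mul]; exact mul_ne_zero hZ hY
  · refine SmoothCubic.weierstrass_discriminant_ne_zero h2 h3 ?_
    rw [← hW]
    exact (smoothCubic_linearSubst (smoothCubic_linearSubst h hZ) hY).C_mul hd
  · rw [linearSubst_mul, hW]

end WeierstrassForm

/-! ### Splitting an alternating tensor along a self-adjoint decomposition -/

section Splitting

open MvPolynomial

theorem polyMat_eq_sum {R : Type*} [CommRing R] {ι : Type*} {d : ℕ} (B : Fin d → Matrix ι ι R) :
    polyMat B = ∑ k, (X k : MvPolynomial (Fin d) R) • (B k).map C := by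
  ext1 i j
  simp [polyMat, Matrix.sum_apply, mul_comm]

theorem polyMat_mul_mul {R : Type*} [CommRing R] {ι κ : Type*} [Fintype ι] {d : ℕ}
    (B : Fin d → Matrix ι ι R) (P : Matrix κ ι R) (Q : Matrix ι κ R) :
    polyMat (fun k => P * B k * Q) =
      (P.map C : Matrix κ ι (MvPolynomial (Fin d) R)) * polyMat B *
        (Q.map C : Matrix ι κ (MvPolynomial (Fin d) R)) := by
  simp only [polyMat_eq_sum, Matrix.map_mul, Matrix.mul_sum, Matrix.sum_mul, Matrix.mul_smul,
    Matrix.smul_mul]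

theorem eval_det_polyMat {R : Type*} [CommRing R] {ι : Type*} [Fintype ι] [DecidableEq ι] {d : ℕ}
    (B : Fin d → Matrix ι ι R) (v : Fin d → R) :
    eval v (polyMat B).det = (∑ k, v k • B k).det := by
  rw [RingHom.map_det]
  congr 1
  ext i j
  simp [polyMat, Matrix.sum_apply, mul_comm]

theorem det_fromBlocks_zero_neg_transpose {R : Type*} [CommRing R] {n : Type*} [Fintype n]
    [DecidableEq n] (A : Matrix n n R) : (Matrix.fromBlocks 0 A (-Aᵀ) 0).det = A.det ^ 2 := by
  have h : Matrix.fromBlocks 0 A (-Aᵀ) 0 = Matrix.fromBlocks A 0 0 Aᵀ *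
      (Matrix.fromBlocks 1 1 0 1 * Matrix.fromBlocks 1 0 (-1) 1 * Matrix.fromBlocks 1 1 0 1) := by
    simp [Matrix.fromBlocks_multiply]
  rw [h]
  simp only [Matrix.det_mul, Matrix.det_fromBlocks_zero₂₁, Matrix.det_fromBlocks_zero₁₂,
    Matrix.det_transpose, Matrix.det_one]
  ring

theorem det_transpose_mul_mul {R : Type*} [CommRing R] {m n : Type*} [Fintype m] [DecidableEq m]
    [Fintype n] [DecidableEq n] (e : m ≃ n) (A : Matrix m m R) (Q : Matrix m n R) :
    (Qᵀ * A * Q).det = (Q.submatrix id e).det ^ 2 * A.det := by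
  rw [← Matrix.det_submatrix_equiv_self e]
  have : (Qᵀ * A * Q).submatrix e e = (Q.submatrix id e)ᵀ * A * Q.submatrix id e := by
    ext i j
    simp [Matrix.mul_apply]
  rw [this, Matrix.det_mul, Matrix.det_mul, Matrix.det_transpose]
  ring

variable {K : Type*} [Field K]

/-- An idempotent `P` with `Pᵀ N = N (1 - P)` for a nonsingular `N` has equidimensional range and
kernel, and is diagonalized by some change of basis. -/
theorem exists_diagonalization_of_idempotent {N P : Matrix (Fin 6) (Fin 6) K} (hN : N.det ≠ 0)
    (hP : P * P = P) (hPN : Pᵀ * N = N * (1 - P)) :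
    ∃ (Q : Matrix (Fin 6) (Fin 3 ⊕ Fin 3) K) (Q' : Matrix (Fin 3 ⊕ Fin 3) (Fin 6) K),
      Q * Q' = 1 ∧ Q' * Q = 1 ∧
        P * Q = Q * (Matrix.fromBlocks 1 0 0 0 : Matrix (Fin 3 ⊕ Fin 3) (Fin 3 ⊕ Fin 3) K) := by
  set p := Matrix.toLin' P with hp
  have hpp (u) : p (p u) = p u := by simp [hp, Matrix.mulVec_mulVec, hP]
  have hcompl : IsCompl (LinearMap.range p) (LinearMap.ker p) := by
    refine ⟨?_, ?_⟩
    · rw [Submodule.disjoint_def]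
      rintro _ ⟨u, rfl⟩ hu
      rw [LinearMap.mem_ker, hpp] at hu
      exact hu
    · rw [codisjoint_iff_le_sup]
      intro u _
      rw [← sub_add_cancel u (p u), add_comm]
      exact Submodule.add_mem_sup ⟨u, rfl⟩ (by simp [hpp])
  have hker : LinearMap.ker p = LinearMap.range (Matrix.toLin' (1 - P)) := by
    ext u
    constructor
    · intro hu
      refine ⟨u, ?_⟩
      rw [map_sub, Matrix.toLin'_one, LinearMap.sub_apply, ← hp, hu]
      simp
    · rintro ⟨w, rfl⟩
      rw [map_sub, Matrix.toLin'_one, LinearMap.sub_apply, ← hp]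
      simp [hpp]
  have hrank : (1 - P).rank = P.rank := by
    have hNu : IsUnit N.det := isUnit_iff_ne_zero.2 hN
    rw [← Matrix.rank_mul_eq_right_of_isUnit_det N (1 - P) hNu, ← hPN,
      Matrix.rank_mul_eq_left_of_isUnit_det N _ hNu, Matrix.rank_transpose]
  have hsum := LinearMap.finrank_range_add_finrank_ker p
  have hr : Module.finrank K (LinearMap.range p) = P.rank := rfl
  have hk : Module.finrank K (LinearMap.ker p) = P.rank := by
    rw [hker, ← hrank]
    rfl
  have h3 : P.rank = 3 := by
    rw [hr, hk, Module.finrank_fin_fun] at hsum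
    omega
  let b := ((Module.finBasisOfFinrankEq K _ (hr.trans h3)).prod
    (Module.finBasisOfFinrankEq K _ (hk.trans h3))).map (Submodule.prodEquivOfIsCompl _ _ hcompl)
  refine ⟨(Pi.basisFun K (Fin 6)).toMatrix b, b.toMatrix (Pi.basisFun K (Fin 6)),
    Module.Basis.toMatrix_mul_toMatrix_flip _ _, Module.Basis.toMatrix_mul_toMatrix_flip _ _, ?_⟩
  ext i j
  have hmul : (P * (Pi.basisFun K (Fin 6)).toMatrix b) i j = p (b j) i := by
    simp [hp, Matrix.mul_apply, Matrix.mulVec, dotProduct, Module.Basis.toMatrix_apply]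
  rw [hmul]
  rcases j with j | j
  · have : p (b (Sum.inl j)) = b (Sum.inl j) := by
      obtain ⟨u, hu⟩ := (Module.finBasisOfFinrankEq K _ (hr.trans h3) j).2
      simp [b, ← hu, hpp]
    rw [this]
    simp [Matrix.mul_apply, Matrix.one_apply, Module.Basis.toMatrix_apply]
  · have : p (b (Sum.inr j)) = 0 := by
      simp [b]
    rw [this]
    simp [Matrix.mul_apply]

theorem exists_blocks_of_idempotent {B : Fin 3 → Matrix (Fin 6) (Fin 6) K}
    (hskew : ∀ k, (B k)ᵀ = -(B k)) {v : Fin 3 → K} (hv : (∑ k, v k • B k).det ≠ 0)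
    {P : Matrix (Fin 6) (Fin 6) K} (hP : P * P = P) (hPB : ∀ k, Pᵀ * B k = B k * (1 - P)) :
    ∃ (Q : Matrix (Fin 6) (Fin 3 ⊕ Fin 3) K) (Q' : Matrix (Fin 3 ⊕ Fin 3) (Fin 6) K)
      (M : Fin 3 → Matrix (Fin 3) (Fin 3) K), Q * Q' = 1 ∧ Q' * Q = 1 ∧
      ∀ k, Qᵀ * B k * Q = Matrix.fromBlocks 0 (M k) (-(M k)ᵀ) 0 := by
  obtain ⟨Q, Q', hQ, hQ', hPQ⟩ := exists_diagonalization_of_idempotent hv hP (by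
    simp only [Matrix.mul_sum, Matrix.sum_mul, Matrix.mul_smul, Matrix.smul_mul, hPB])
  refine ⟨Q, Q', fun k => (Qᵀ * B k * Q).toBlocks₁₂, hQ, hQ', fun k => ?_⟩
  have hsk : (Qᵀ * B k * Q)ᵀ = -(Qᵀ * B k * Q) := by
    simp [Matrix.transpose_mul, hskew, Matrix.mul_assoc]
  have h1 : (Matrix.fromBlocks 1 0 0 0 : Matrix (Fin 3 ⊕ Fin 3) (Fin 3 ⊕ Fin 3) K)ᵀ *
      (Qᵀ * B k * Q) = (Qᵀ * B k * Q) * (1 -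
        (Matrix.fromBlocks 1 0 0 0 : Matrix (Fin 3 ⊕ Fin 3) (Fin 3 ⊕ Fin 3) K)) := by
    calc _ = (P * Q)ᵀ * B k * Q := by rw [hPQ, Matrix.transpose_mul]; simp only [Matrix.mul_assoc]
      _ = Qᵀ * (Pᵀ * B k) * Q := by rw [Matrix.transpose_mul]; simp only [Matrix.mul_assoc]
      _ = Qᵀ * B k * (Q - P * Q) := by
        rw [hPB]; simp only [Matrix.mul_assoc, Matrix.sub_mul, Matrix.one_mul]
      _ = _ := by rw [hPQ]; simp only [Matrix.mul_assoc, Matrix.mul_sub, Matrix.mul_one]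
  change Qᵀ * B k * Q = Matrix.fromBlocks 0 (Qᵀ * B k * Q).toBlocks₁₂
    (-((Qᵀ * B k * Q).toBlocks₁₂)ᵀ) 0
  generalize Qᵀ * B k * Q = T at hsk h1 ⊢
  obtain ⟨T₁, T₂, T₃, T₄, rfl⟩ : ∃ T₁ T₂ T₃ T₄, T = Matrix.fromBlocks T₁ T₂ T₃ T₄ :=
    ⟨_, _, _, _, (Matrix.fromBlocks_toBlocks T).symm⟩
  rw [← Matrix.fromBlocks_one, Matrix.fromBlocks_transpose, sub_eq_add_neg, Matrix.fromBlocks_neg,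
    Matrix.fromBlocks_add, Matrix.fromBlocks_multiply, Matrix.fromBlocks_multiply,
    Matrix.fromBlocks_inj] at h1
  rw [Matrix.fromBlocks_transpose, Matrix.fromBlocks_neg, Matrix.fromBlocks_inj] at hsk
  simp at h1
  rw [Matrix.toBlocks_fromBlocks₁₂, Matrix.fromBlocks_inj]
  refine ⟨h1.1, rfl, ?_, h1.2.symm⟩
  rw [hsk.2.2.1, neg_neg]

theorem sum_smul_fromBlocks_zero_neg_transpose {R ι n : Type*} [CommRing R] [Fintype ι]
    (M : ι → Matrix n n R) (c : ι → R) :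
    ∑ i, c i • Matrix.fromBlocks 0 (M i) (-(M i)ᵀ) 0 =
      Matrix.fromBlocks 0 (∑ i, c i • M i) (-(∑ i, c i • M i)ᵀ) 0 := by
  ext (i | i) (j | j) <;> simp [Matrix.sum_apply]

theorem matTensor_mulVec {R : Type*} [CommRing R] {ι κ : Type*} [Fintype ι] [Fintype κ] {d : ℕ}
    (B : Fin d → Matrix ι ι R) (S : Matrix ι κ R) (u v : κ → R) :
    matTensor B (S *ᵥ u) (S *ᵥ v) = matTensor (fun k => Sᵀ * B k * S) u v := by
  funext k
  simp only [matTensor, ← Matrix.mulVec_mulVec]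
  rw [Matrix.dotProduct_mulVec u, Matrix.vecMul_transpose]

theorem matTensor_sum_smul {R : Type*} [CommRing R] {ι : Type*} [Fintype ι] {d e : ℕ}
    (B : Fin d → Matrix ι ι R) (Z : Matrix (Fin d) (Fin e) R) (u v : ι → R) :
    matTensor (fun j => ∑ i, Z i j • B i) u v = Zᵀ *ᵥ matTensor B u v := by
  funext j
  simp only [matTensor, Matrix.sum_mulVec, dotProduct_sum, Matrix.smul_mulVec, dotProduct_smul,
    smul_eq_mul]
  rfl

/-- Invertible changes of basis on `V` and `T` carrying one tensor to another induce an
isomorphism of Baer groups. -/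
theorem exists_equiv_baer_of_sum_smul_eq {ι κ : Type*} [Fintype ι] [Fintype κ] [DecidableEq ι]
    [DecidableEq κ] {d : ℕ} {B : Fin d → Matrix ι ι K} {B' : Fin d → Matrix κ κ K}
    {S : Matrix κ ι K} {R : Matrix ι κ K} (hRS : R * S = 1) (hSR : S * R = 1)
    {Z : Matrix (Fin d) (Fin d) K} (hZ : Z.det ≠ 0)
    (h : ∀ j, Sᵀ * B' j * S = ∑ i, Z i j • B i) :
    ∃ e : (ι → K) × (Fin d → K) ≃ (κ → K) × (Fin d → K),
      ∀ x y, e (baerMul (K := K) (matTensor B) x y) =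
        baerMul (K := K) (matTensor B') (e x) (e y) := by
  have hZu : IsUnit Zᵀ.det := by rwa [Matrix.det_transpose, isUnit_iff_ne_zero]
  refine ⟨⟨fun p => (S *ᵥ p.1, Zᵀ *ᵥ p.2), fun p => (R *ᵥ p.1, (Zᵀ)⁻¹ *ᵥ p.2), fun p => ?_,
    fun p => ?_⟩, fun x y => ?_⟩
  · simp [Matrix.mulVec_mulVec, hRS, Matrix.nonsing_inv_mul _ hZu]
  · simp [Matrix.mulVec_mulVec, hSR, Matrix.mul_nonsing_inv _ hZu]
  · simp [baerMul, Matrix.mulVec_add, Matrix.mulVec_smul, matTensor_mulVec, h, matTensor_sum_smul]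

theorem IsJmatEquiv.exists_equiv_baer {B : Fin 3 → Matrix (Fin 6) (Fin 6) K}
    {Q : Matrix (Fin 6) (Fin 3 ⊕ Fin 3) K} {Q' : Matrix (Fin 3 ⊕ Fin 3) (Fin 6) K}
    {M : Fin 3 → Matrix (Fin 3) (Fin 3) K} (hQ : Q * Q' = 1) (hQ' : Q' * Q = 1)
    (hB : ∀ k, Qᵀ * B k * Q = Matrix.fromBlocks 0 (M k) (-(M k)ᵀ) 0)
    {Z : Matrix (Fin 3) (Fin 3) K} (hZ : Z.det ≠ 0) {a b : K}
    (h : IsJmatEquiv (fun j => ∑ i, Z i j • M i) a b) :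
    ∃ lam mu : K, mu ^ 2 = lam ^ 3 + a * lam + b ∧
      ∃ e : (Fin 6 → K) × (Fin 3 → K) ≃ ((Fin 3 ⊕ Fin 3) → K) × (Fin 3 → K),
        ∀ x y, e (baerMul (K := K) (matTensor B) x y) =
          baerMul (K := K) (epTensor a lam mu) (e x) (e y) := by
  obtain ⟨X, Y, lam, mu, hX, hY, hP, hJ⟩ := h
  refine ⟨lam, mu, hP, ?_⟩
  have hXu : IsUnit Xᵀ.det := by rwa [Matrix.det_transpose, isUnit_iff_ne_zero]
  have hYu : IsUnit Y.det := isUnit_iff_ne_zero.2 hY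
  set D : Matrix (Fin 3 ⊕ Fin 3) (Fin 3 ⊕ Fin 3) K := Matrix.fromBlocks Xᵀ 0 0 Y with hD
  set D' : Matrix (Fin 3 ⊕ Fin 3) (Fin 3 ⊕ Fin 3) K := Matrix.fromBlocks (Xᵀ)⁻¹ 0 0 Y⁻¹ with hD'
  have hDD' : D * D' = 1 := by
    simp [hD, hD', Matrix.fromBlocks_multiply, Matrix.mul_nonsing_inv _ hXu,
      Matrix.mul_nonsing_inv _ hYu]
  have hD'D : D' * D = 1 := mul_eq_one_comm.1 hDD'
  have hRS : Q * D * (D' * Q') = 1 := by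
    rw [Matrix.mul_assoc, ← Matrix.mul_assoc D, hDD', Matrix.one_mul, hQ]
  have hSR : D' * Q' * (Q * D) = 1 := by
    rw [Matrix.mul_assoc, ← Matrix.mul_assoc Q', hQ', Matrix.one_mul, hD'D]
  have hblock (j) : BmatEP a lam mu j = (Q * D)ᵀ * (∑ i, Z i j • B i) * (Q * D) := by
    calc BmatEP a lam mu j
        = Dᵀ * Matrix.fromBlocks 0 (∑ i, Z i j • M i) (-(∑ i, Z i j • M i)ᵀ) 0 * D := by
          rw [BmatEP, ← hJ j, hD]
          simp [Matrix.fromBlocks_transpose, Matrix.fromBlocks_multiply, Matrix.mul_assoc]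
      _ = Dᵀ * (Qᵀ * (∑ i, Z i j • B i) * Q) * D := by
          rw [← sum_smul_fromBlocks_zero_neg_transpose]
          simp only [Matrix.mul_sum, Matrix.sum_mul, Matrix.mul_smul, Matrix.smul_mul, hB]
      _ = _ := by simp only [Matrix.transpose_mul, Matrix.mul_assoc]
  refine exists_equiv_baer_of_sum_smul_eq hRS hSR hZ fun j => ?_
  rw [hblock j]
  calc _ = (Q * D * (D' * Q'))ᵀ * (∑ i, Z i j • B i) * (Q * D * (D' * Q')) := by
        rw [Matrix.transpose_mul (Q * D)]; simp only [Matrix.mul_assoc]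
    _ = _ := by rw [hRS, Matrix.transpose_one, Matrix.one_mul, Matrix.mul_one]

theorem det_polyMat_fromBlocks {R : Type*} [CommRing R] {n : Type*} [Fintype n] [DecidableEq n]
    {d : ℕ} (M : Fin d → Matrix n n R) :
    (polyMat fun k => Matrix.fromBlocks 0 (M k) (-(M k)ᵀ) 0).det = (polyMat M).det ^ 2 := by
  rw [← det_fromBlocks_zero_neg_transpose]
  congr 1
  ext1 (i | i) (j | j) <;> simp [polyMat]

theorem exists_isEPForm_of_idempotent (h2 : (2 : K) ≠ 0) (h3 : (3 : K) ≠ 0)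
    {B : Fin 3 → Matrix (Fin 6) (Fin 6) K} (hskew : ∀ k, (B k)ᵀ = -(B k))
    {f : MvPolynomial (Fin 3) K} (hf : SmoothCubic f) (hflex : HasRationalFlex f)
    (hdet : (polyMat B).det = f ^ 2) {P : Matrix (Fin 6) (Fin 6) K} (hP : P * P = P)
    (hPB : ∀ k, Pᵀ * B k = B k * (1 - P)) :
    ∃ a b lam mu : K, IsEPForm B f a b lam mu := by
  obtain ⟨v, hv⟩ : ∃ v, eval v f ≠ 0 := by
    by_contra! h
    exact hf.ne_zero (eq_of_eval_eq_of_isHomogeneous_three h2 hf.1 (isHomogeneous_zero _ _ _)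
      (by simpa using h))
  have hBv : (∑ k, v k • B k).det ≠ 0 := by
    rw [← eval_det_polyMat, hdet, map_pow]
    exact pow_ne_zero 2 hv
  obtain ⟨Q, Q', M, hQ, hQ', hM⟩ := exists_blocks_of_idempotent hskew hBv hP hPB
  obtain ⟨s, hs, hsM⟩ : ∃ s : K, s ≠ 0 ∧ (polyMat M).det = C s * f := by
    let e : Fin 6 ≃ Fin 3 ⊕ Fin 3 := (finSumFinEquiv (m := 3) (n := 3)).symm
    have hδ : (Q.submatrix id e).det ≠ 0 := by
      have : Q.submatrix id e * Q'.submatrix e id = 1 := by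
        rw [Matrix.submatrix_mul_equiv, hQ, Matrix.submatrix_id_id]
      exact Matrix.det_ne_zero_of_right_inverse this
    have hsq : (polyMat M).det ^ 2 = (C (Q.submatrix id e).det * f) ^ 2 := by
      rw [← det_polyMat_fromBlocks]
      simp only [← hM]
      rw [polyMat_mul_mul, Matrix.transpose_map, det_transpose_mul_mul e, hdet, mul_pow,
        RingHom.map_det]
      rfl
    rcases sq_eq_sq_iff_eq_or_eq_neg.1 hsq with h | h
    · exact ⟨_, hδ, h⟩
    · exact ⟨_, neg_ne_zero.2 hδ, by rw [h, map_neg, neg_mul]⟩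
  obtain ⟨Z, hZ, d, a, b, hd, hab, hW⟩ := hf.exists_weierstrass h2 h3 hflex
  have hrep : IsWeierstrassRep (fun j => ∑ i, Z i j • M i) a b (s / d) := by
    intro x y z
    have hWv := congrArg (eval ![x, y, z]) hW
    have hMv := congrArg (eval (Z *ᵥ ![x, y, z])) hsM
    rw [eval_det_polyMat, map_mul, eval_C, ← eval_linearSubst] at hMv
    have hsum : x • ∑ i, Z i 0 • M i + y • ∑ i, Z i 1 • M i + z • ∑ i, Z i 2 • M i =
        ∑ k, (Z *ᵥ ![x, y, z]) k • M k := by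
      simp only [Fin.sum_univ_three, Matrix.mulVec, dotProduct, Matrix.cons_val_zero,
        Matrix.cons_val_one, Matrix.cons_val]
      module
    rw [hsum, hMv]
    simp only [weierstrassCubic, map_mul, map_sub, map_pow, eval_C, eval_X, Matrix.cons_val_zero,
      Matrix.cons_val_one, Matrix.cons_val] at hWv
    rw [← hWv]
    field_simp
  obtain ⟨lam, mu, hcurve, e, he⟩ :=
    (hrep.isJmatEquiv h2 (div_ne_zero hs hd)).exists_equiv_baer hQ hQ' hM hZ
  exact ⟨a, b, lam, mu, hab, hcurve,
    ⟨Z, (Matrix.isUnit_iff_isUnit_det Z).2 (isUnit_iff_ne_zero.2 hZ), d, hd, hW⟩, e, he⟩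

end Splitting

/-- Let `K` be a field with `6` invertible, `B ∈ Mat₆(K[y₁,y₂,y₃]₁)`
skew-symmetric with `det(B) = f²` for a smooth homogeneous cubic `f` whose zero locus `E`
has a `K`-rational flex point, and let `G = G_B(K)`.  Then:
(1) `Adj(t)` is *-isomorphic to `X₁(K)` iff there are `a, b` with `4a³ + 27b² ≠ 0`, an
affine point `P = (λ,μ)` on `E_W : y² = x³ + ax + b` with `μ ≠ 0` (`P ∉ E_W[2](K)`),
`Z ∈ GL₃(K)` and `c ∈ K^×` with `c·f(Z·(x,y,z)) = y²z − x³ − axz² − bz³`, and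
`G ≅ G_{E_W,P}(K)`;
(2) `Adj(t)` is *-isomorphic to `S₂(K)` iff such data exist with `μ = 0`
(`P ∈ E_W[2](K) ∖ {O}`). -/
theorem statement2 {K : Type*} [Field K] (hsix : (6 : K) ≠ 0)
    (B : Fin 3 → Matrix (Fin 6) (Fin 6) K)
    (hskew : ∀ k, (B k)ᵀ = -(B k))
    (f : MvPolynomial (Fin 3) K) (hsmooth : SmoothCubic f) (hflex : HasRationalFlex f)
    (hdet : (polyMat B).det = f ^ 2) :
    (StarIsoX1 (adjPair B) ↔
      ∃ a b lam mu : K, mu ≠ 0 ∧ IsEPForm B f a b lam mu) ∧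
    (StarIsoS2 (adjPair B) ↔
      ∃ a b lam mu : K, mu = 0 ∧ IsEPForm B f a b lam mu) := by
  have h2 : (2 : K) ≠ 0 := fun h => hsix (by linear_combination 3 * h)
  have h3 : (3 : K) ≠ 0 := fun h => hsix (by linear_combination 2 * h)
  have hdet0 : (polyMat B).det ≠ 0 := by
    rw [hdet]
    exact pow_ne_zero 2 hsmooth.ne_zero
  refine ⟨⟨fun h => ?_, ?_⟩, ⟨fun h => ?_, ?_⟩⟩
  · obtain ⟨P, hP, hPB⟩ := (starIsoX1_iff.1 h).exists_idempotent hskew (x := (1, 0)) (by simp)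
      (by simp)
    obtain ⟨a, b, lam, mu, hE⟩ :=
      exists_isEPForm_of_idempotent h2 h3 hskew hsmooth hflex hdet hP hPB
    refine ⟨a, b, lam, mu, ?_, hE⟩
    rintro rfl
    exact not_starIsoX1_and_starIsoS2 B ⟨h, starIsoS2_of_baer h2 hskew hdet0 hE.2.2.2⟩
  · rintro ⟨a, b, lam, mu, hmu, hE⟩
    exact starIsoX1_of_baer h2 hskew hdet0 hmu hE.2.2.2
  · obtain ⟨P, hP, hPB⟩ := (starIsoS2_iff.1 h).exists_idempotent hskew (x := !![1, 0; 0, 0])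
      (by ext i j; fin_cases i <;> fin_cases j <;> simp [Matrix.mul_apply])
      (by rw [symplectic_involution_fin_two]; simp [Matrix.one_fin_two])
    obtain ⟨a, b, lam, mu, hE⟩ :=
      exists_isEPForm_of_idempotent h2 h3 hskew hsmooth hflex hdet hP hPB
    refine ⟨a, b, lam, mu, ?_, hE⟩
    by_contra hmu
    exact not_starIsoX1_and_starIsoS2 B ⟨starIsoX1_of_baer h2 hskew hdet0 hmu hE.2.2.2, h⟩
  · rintro ⟨a, b, lam, mu, rfl, hE⟩
    exact starIsoS2_of_baer h2 hskew hdet0 hE.2.2.2
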